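/- Let n ≥ 2, let z_1, …, z_n ∈ ℂ be distinct, let m_1, …, m_n > 0, let γ ∈ ℂ with γ ≠ 0, and let η(z) = z − γ·conj(z) − Σ_{j=1}^n m_j/(conj(z) − conj(z_j)) on ℂ \ {z_1, …, z_n}. Then for every ζ ∈ ℂ, the set of images {z ∈ ℂ \ {z_1, …, z_n} : η(z) = ζ} is finite and has at most 5n − 1 elements. -/

import Mathlib

section partP1
open Topology Filter

/-- Differentiating a continuous lift through a map with nonzero derivative. -/
lemma lift_hasDerivAt {h G k : ℂ → ℂ} {d k' u : ℂ} (hd : HasStrictDerivAt h d (G u)) (hd0 : d ≠ 0)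
    (hG : ContinuousAt G u) (hk : HasDerivAt k k' u) (he : ∀ᶠ v in 𝓝 u, h (G v) = k v) :
    HasDerivAt G (k' / d) u := by
  have h1 : h (G u) = k u := he.self_of_nhds
  have h2 := (hd.to_localInverse hd0).hasDerivAt
  have h3 := (hd.hasStrictFDerivAt_equiv hd0).eventually_left_inverse
  have h4 := hG.eventually h3
  rw [h1] at h2
  have h5 := h2.comp u hk
  have h6 : HasDerivAt G (d⁻¹ * k') u := by
    refine h5.congr_of_eventuallyEq ?_
    filter_upwards [he, h4] with v hv1 hv2
    simp only [Function.comp]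
    rw [← hv1]
    exact hv2.symm
  convert h6 using 1
  field_simp

lemma lift_step {Rh : OnePoint ℂ → OnePoint ℂ} {α : ℂ → OnePoint ℂ}
    (hα : IsOpenEmbedding α) {B : Set (OnePoint ℂ)} (hcov : IsCoveringMapOn Rh B)
    (hBinv : ∀ y, Rh y ∈ B ↔ y ∈ B) (hBr : B ⊆ Set.range α) {h : ℂ → ℂ}
    (hh : ∀ u, α u ∈ B → Rh (α u) = α ((starRingEnd ℂ) (h u)))
    {u0 : ℂ} {δ : ℝ} (hδ : 0 < δ) (hfix : (starRingEnd ℂ) (h u0) = u0)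
    {G : ℂ → ℂ} (hG : ContinuousOn G (Metric.ball u0 δ)) (hGB : ∀ u ∈ Metric.ball u0 δ, α (G u) ∈ B)
    (hG0 : G u0 = u0) :
    ∃ G1 : ℂ → ℂ, ContinuousOn G1 (Metric.ball u0 δ) ∧ (∀ u ∈ Metric.ball u0 δ, α (G1 u) ∈ B) ∧
      G1 u0 = u0 ∧ ∀ u ∈ Metric.ball u0 δ, h (G1 u) = (starRingEnd ℂ) (G u) := by
  have hu0 : u0 ∈ Metric.ball u0 δ := by simpa
  have := (convex_ball u0 δ).contractibleSpace ⟨u0, hu0⟩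
  have : LocallyPathConnectedSpace (Metric.ball u0 δ) := Metric.isOpen_ball.locallyPathConnectedSpace
  let f : C(Metric.ball u0 δ, OnePoint ℂ) :=
    ⟨fun a => α (G a), hα.continuous.comp (continuousOn_iff_continuous_domRestrict.1 hG)⟩
  have hx : α u0 ∈ B := by simpa [hG0] using hGB u0 hu0
  obtain ⟨F, ⟨hF0, hF⟩, -⟩ := hcov.existsUnique_continuousMap_lifts f (a₀ := ⟨u0, hu0⟩) (e₀ := α u0)
    (by rw [hh _ hx, hfix]; simp [f, hG0]) (fun a => hGB a a.2)
  have hFB : ∀ a, F a ∈ B := fun a => by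
    rw [← hBinv]
    have : Rh (F a) = f a := congrFun hF a
    rw [this]; exact hGB a a.2
  have hFr : ∀ a, ∃ u, α u = F a := fun a => hBr (hFB a)
  choose g hg using hFr
  have hgc : Continuous g := by
    rw [hα.isInducing.continuous_iff]
    convert F.continuous using 1
    funext a; exact hg a
  classical
  have key : ∀ u (hu : u ∈ Metric.ball u0 δ),
      (fun u => if hu : u ∈ Metric.ball u0 δ then g ⟨u, hu⟩ else 0) u = g ⟨u, hu⟩ := by
    intro u hu; simp only [dif_pos hu]
  refine ⟨fun u => if hu : u ∈ Metric.ball u0 δ then g ⟨u, hu⟩ else 0, ?_, ?_, ?_, ?_⟩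
  · rw [continuousOn_iff_continuous_domRestrict]
    convert hgc using 1
    funext a
    exact key a a.2
  · intro u hu
    rw [key u hu, hg]; exact hFB _
  · rw [key u0 hu0]
    apply hα.injective
    rw [hg, hF0]
  · intro u hu
    rw [key u hu]
    have h1 : Rh (F ⟨u, hu⟩) = α (G u) := congrFun hF ⟨u, hu⟩
    rw [← hg, hh _ (by rw [hg]; exact hFB _)] at h1
    rw [← hα.injective h1, Complex.conj_conj]

/-- Abstract form of the theorem of Fatou: an antiholomorphic covering of a domain omitting a disc
has no attracting fixed point. -/
lemma fatou_abs {Rh : OnePoint ℂ → OnePoint ℂ} (hRh : Continuous Rh) {α : ℂ → OnePoint ℂ}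
    (hα : IsOpenEmbedding α) {B : Set (OnePoint ℂ)} (hB : IsOpen B)
    (hBinv : ∀ y, Rh y ∈ B ↔ y ∈ B) (hBr : B ⊆ Set.range α) {h : ℂ → ℂ}
    (hh : ∀ u, α u ∈ B → Rh (α u) = α ((starRingEnd ℂ) (h u)))
    (hd : ∀ u, α u ∈ B → ∃ d, d ≠ 0 ∧ HasStrictDerivAt h d u)
    {u0 d0 : ℂ} (hx : α u0 ∈ B) (hfix : (starRingEnd ℂ) (h u0) = u0)
    (hd0 : HasDerivAt h d0 u0) (hlt : ‖d0‖ < 1)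
    {a : ℂ} {ρ : ℝ} (hρ : 0 < ρ) (hmiss : ∀ u ∈ Metric.ball a ρ, α u ∉ B) : False := by
  have hBα : IsOpen (α ⁻¹' B) := hB.preimage hα.continuous
  have hloc : IsLocalHomeomorphOn Rh (Rh ⁻¹' B) := by
    apply IsLocalHomeomorphOn.mk
    intro y hy
    have hyB : y ∈ B := (hBinv y).1 hy
    obtain ⟨u, rfl⟩ := hBr hyB
    obtain ⟨d, hd1, hd2⟩ := hd u hyB
    let e := hα.toOpenPartialHomeomorph α
    let φ := (hd2.hasStrictFDerivAt_equiv hd1).toOpenPartialHomeomorph h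
    let cj := (Complex.conjLIE.toHomeomorph).toOpenPartialHomeomorph
    let E := (((e.symm.trans φ).trans cj).trans e).restrOpen B hB
    have hE : ∀ v, α v ∈ B → E (α v) = α ((starRingEnd ℂ) (h v)) := by
      intro v hv
      have : e.symm (α v) = v := hα.toOpenPartialHomeomorph_left_inv
      simp [E, this, e, φ, cj]
    refine ⟨E, ?_, ?_⟩
    · have h1 : e.symm (α u) = u := hα.toOpenPartialHomeomorph_left_inv
      have h2 : u ∈ φ.source := (hd2.hasStrictFDerivAt_equiv hd1).mem_toOpenPartialHomeomorph_source
      simp [E, cj, e, h1, h2, hyB]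
    · intro y' hy'
      have hy'B : y' ∈ B := by
        have : y' ∈ _ ∩ B := hy'
        exact this.2
      obtain ⟨v, rfl⟩ := hBr hy'B
      rw [hE v hy'B, hh v hy'B]
  have hcov : IsCoveringMapOn Rh B := IsCoveringMapOn.of_isLocalHomeomorphOn hRh hloc
  obtain ⟨δ, hδ, hδB⟩ := Metric.isOpen_iff.1 hBα u0 hx
  have hu0 : u0 ∈ Metric.ball u0 δ := by simpa
  have hd0' : d0 ≠ 0 := by
    obtain ⟨d, hd1, hd2⟩ := hd u0 hx
    rwa [hd0.unique hd2.hasDerivAt]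
  have main : ∀ k : ℕ, ∃ G : ℂ → ℂ, (∀ u ∈ Metric.ball u0 δ, DifferentiableAt ℂ G u) ∧
      (∀ u ∈ Metric.ball u0 δ, α (G u) ∈ B) ∧ G u0 = u0 ∧
      HasDerivAt G (((((starRingEnd ℂ) d0) * d0) ^ k)⁻¹) u0 := by
    intro k
    induction k with
    | zero => exact ⟨id, fun u _ => differentiableAt_id, fun u hu => hδB hu, rfl, by
        simpa using hasDerivAt_id u0⟩
    | succ k ih =>
      obtain ⟨G, hG1, hG2, hG3, hG4⟩ := ih
      obtain ⟨G1, h11, h12, h13, h14⟩ := lift_step hα hcov hBinv hBr hh hδ hfix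
        (fun u hu => (hG1 u hu).continuousAt.continuousWithinAt) hG2 hG3
      obtain ⟨G2, h21, h22, h23, h24⟩ := lift_step hα hcov hBinv hBr hh hδ hfix h11 h12 h13
      -- derivative of `conj ∘ G1`
      have key1 : ∀ u ∈ Metric.ball u0 δ, ∀ k' d, HasDerivAt G k' u → d ≠ 0 →
          HasStrictDerivAt h d (G1 u) →
          HasDerivAt (fun v => (starRingEnd ℂ) (G1 v)) (k' / (starRingEnd ℂ) d) u := by
        intro u hu k' d hk' hd1 hd2
        have hnb : Metric.ball u0 δ ∈ 𝓝 u := Metric.isOpen_ball.mem_nhds hu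
        have a1 := hk'.conj_conj
        have hcu : Filter.Tendsto (starRingEnd ℂ) (𝓝 ((starRingEnd ℂ) u)) (𝓝 u) := by
          have := (Complex.continuous_conj.tendsto ((starRingEnd ℂ) u))
          rwa [Complex.conj_conj] at this
        have a2 := lift_hasDerivAt (h := h) (G := fun v => G1 ((starRingEnd ℂ) v))
          (u := (starRingEnd ℂ) u) (d := d) (by simpa using hd2) hd1
          (by
            have : ContinuousAt G1 ((starRingEnd ℂ) ((starRingEnd ℂ) u)) := by
              rw [Complex.conj_conj]; exact (h11.continuousAt hnb)
            exact this.comp Complex.continuous_conj.continuousAt) a1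
          (by
            filter_upwards [hcu hnb] with v hv
            exact h14 _ hv)
        have a3 := a2.conj_conj
        simp only [Complex.conj_conj, map_div₀] at a3
        refine a3.congr_of_eventuallyEq (Eventually.of_forall fun v => ?_)
        simp [Function.comp]
      have key2 : ∀ u ∈ Metric.ball u0 δ, ∀ k' d d', HasDerivAt G k' u → d ≠ 0 →
          HasStrictDerivAt h d (G1 u) → d' ≠ 0 → HasStrictDerivAt h d' (G2 u) →
          HasDerivAt G2 (k' / (starRingEnd ℂ) d / d') u := by
        intro u hu k' d d' hk' hd1 hd2 hd1' hd2'
        have hnb : Metric.ball u0 δ ∈ 𝓝 u := Metric.isOpen_ball.mem_nhds hu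
        refine lift_hasDerivAt hd2' hd1' (h21.continuousAt hnb) (key1 u hu k' d hk' hd1 hd2) ?_
        filter_upwards [hnb] with v hv
        exact h24 v hv
      refine ⟨G2, ?_, h22, h23, ?_⟩
      · intro u hu
        obtain ⟨d, hd1, hd2⟩ := hd _ (h12 u hu)
        obtain ⟨d', hd1', hd2'⟩ := hd _ (h22 u hu)
        exact (key2 u hu _ d d' (hG1 u hu).hasDerivAt hd1 hd2 hd1' hd2').differentiableAt
      · obtain ⟨d, hd1, hd2⟩ := hd _ hx
        have : d0 = d := hd0.unique hd2.hasDerivAt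
        subst this
        have := key2 u0 hu0 _ d0 d0 hG4 hd1 (by rw [h13]; exact hd2) hd1 (by rw [h23]; exact hd2)
        convert this using 1
        have : (starRingEnd ℂ) d0 ≠ 0 := by simpa using hd1
        rw [pow_succ]
        field_simp
  -- Cauchy estimate
  set q : ℝ := ‖d0‖ ^ 2 with hq
  have hqpos : 0 < q := by have := norm_pos_iff.2 hd0'; positivity
  have hq1 : q < 1 := by
    have := norm_nonneg d0
    rw [hq]; nlinarith
  have hua : u0 - a ≠ 0 := by
    intro h0
    apply hmiss u0 _ hx
    rw [sub_eq_zero] at h0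
    simp [h0, hρ]
  have est : ∀ k : ℕ, (q ^ k)⁻¹ / ‖u0 - a‖ ^ 2 ≤ ρ⁻¹ / (δ / 2) := by
    intro k
    obtain ⟨G, hG1, hG2, hG3, hG4⟩ := main k
    have hGa : ∀ u ∈ Metric.ball u0 δ, ρ ≤ ‖G u - a‖ := by
      intro u hu
      by_contra hlt'
      push Not at hlt'
      exact hmiss (G u) (by simpa [dist_eq_norm] using hlt') (hG2 u hu)
    have hGa0 : ∀ u ∈ Metric.ball u0 δ, G u - a ≠ 0 := by
      intro u hu h0
      have := hGa u hu
      rw [h0, norm_zero] at this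
      linarith
    have hder : HasDerivAt (fun u => (G u - a)⁻¹)
        (-(((((starRingEnd ℂ) d0) * d0) ^ k)⁻¹) / (u0 - a) ^ 2) u0 := by
      have := (hG4.sub_const a).fun_inv (hGa0 u0 hu0)
      simpa [hG3] using this
    have hc := Complex.norm_deriv_le_of_forall_mem_sphere_norm_le (f := fun u => (G u - a)⁻¹)
      (c := u0) (R := δ / 2) (C := ρ⁻¹) (by positivity) ?_ ?_
    · rw [hder.deriv] at hc
      convert hc using 1
      simp [hq, norm_inv, norm_pow]
      ring_nf
    · apply DifferentiableOn.diffContOnCl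
      rw [closure_ball _ (by positivity)]
      intro u hu
      have hu' : u ∈ Metric.ball u0 δ := Metric.closedBall_subset_ball (by linarith) hu
      exact (((hG1 u hu').sub_const a).inv (hGa0 u hu')).differentiableWithinAt
    · intro u hu
      have hu' : u ∈ Metric.ball u0 δ :=
        Metric.closedBall_subset_ball (by linarith) (Metric.sphere_subset_closedBall hu)
      rw [norm_inv]
      exact inv_anti₀ hρ (hGa u hu')
  obtain ⟨k, hk⟩ := exists_pow_lt_of_lt_one (y := q)
    (x := (ρ⁻¹ / (δ / 2) * ‖u0 - a‖ ^ 2 + 1)⁻¹) (by positivity) hq1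
  have h1 := est k
  have hn : 0 < ‖u0 - a‖ ^ 2 := by have := norm_pos_iff.2 hua; positivity
  rw [div_le_iff₀ hn] at h1
  have h2 : ρ⁻¹ / (δ / 2) * ‖u0 - a‖ ^ 2 + 1 < (q ^ k)⁻¹ := by
    rw [lt_inv_comm₀ (by positivity) (by positivity)]
    exact hk
  linarith

/-- The basin of a point. -/
def basin (Rh : OnePoint ℂ → OnePoint ℂ) (x : OnePoint ℂ) : Set (OnePoint ℂ) :=
  {y | Tendsto (fun k => Rh^[k] y) atTop (𝓝 x)}

lemma basin_inv (Rh : OnePoint ℂ → OnePoint ℂ) (x y : OnePoint ℂ) :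
    Rh y ∈ basin Rh x ↔ y ∈ basin Rh x := by
  unfold basin
  simp only [Set.mem_ofPred_eq]
  rw [← tendsto_add_atTop_iff_nat (f := fun k => Rh^[k] y) 1]
  simp [Function.iterate_succ_apply]

lemma basin_inv_iter (Rh : OnePoint ℂ → OnePoint ℂ) (x y : OnePoint ℂ) (k : ℕ) :
    Rh^[k] y ∈ basin Rh x ↔ y ∈ basin Rh x := by
  induction k with
  | zero => rfl
  | succ k ih => rw [Function.iterate_succ_apply', basin_inv, ih]

lemma basin_self {Rh : OnePoint ℂ → OnePoint ℂ} {x : OnePoint ℂ} (hx : Rh x = x) :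
    x ∈ basin Rh x := by
  unfold basin
  have : ∀ k, Rh^[k] x = x := fun k => Function.iterate_fixed hx k
  simp [this]

lemma basin_disj {Rh : OnePoint ℂ → OnePoint ℂ} {x x' y : OnePoint ℂ} (h : y ∈ basin Rh x)
    (h' : y ∈ basin Rh x') : x = x' := tendsto_nhds_unique h h'

lemma basin_nhds {Rh : OnePoint ℂ → OnePoint ℂ} {α : ℂ → OnePoint ℂ} (hα : IsOpenEmbedding α)
    {h : ℂ → ℂ} {u0 d : ℂ} (he : ∀ᶠ u in 𝓝 u0, Rh (α u) = α ((starRingEnd ℂ) (h u)))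
    (hd : HasDerivAt h d u0) (hlt : ‖d‖ < 1) (hfix : (starRingEnd ℂ) (h u0) = u0) :
    basin Rh (α u0) ∈ 𝓝 (α u0) := by
  obtain ⟨c, hc1, hc2⟩ := exists_between hlt
  have hO := hd.isLittleO.bound (c := c - ‖d‖) (by linarith)
  have hcontr : ∀ᶠ u in 𝓝 u0, ‖(starRingEnd ℂ) (h u) - u0‖ ≤ c * ‖u - u0‖ := by
    filter_upwards [hO] with u hu
    have h1 : ‖(starRingEnd ℂ) (h u) - u0‖ = ‖h u - h u0‖ := by
      conv_lhs => rw [← hfix]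
      rw [← map_sub]
      rw [← Complex.norm_conj (h u - h u0)]
    rw [h1]
    have h2 : ‖h u - h u0‖ ≤ ‖h u - h u0 - (u - u0) • d‖ + ‖(u - u0) • d‖ := by
      have := norm_add_le (h u - h u0 - (u - u0) • d) ((u - u0) • d)
      simpa using this
    rw [norm_smul] at h2
    nlinarith
  obtain ⟨δ, hδ, hball⟩ := Metric.eventually_nhds_iff_ball.1 (he.and hcontr)
  have hc0 : 0 ≤ c := (norm_nonneg d).trans hc1.le
  rw [← hα.map_nhds_eq u0, Filter.mem_map]
  filter_upwards [Metric.ball_mem_nhds u0 hδ] with u hu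
  have iter : ∀ k : ℕ, ∃ v, Rh^[k] (α u) = α v ∧ ‖v - u0‖ ≤ c ^ k * ‖u - u0‖ := by
    intro k
    induction k with
    | zero => exact ⟨u, rfl, by simp⟩
    | succ k ih =>
      obtain ⟨v, hv1, hv2⟩ := ih
      have hck : c ^ k ≤ 1 := pow_le_one₀ hc0 hc2.le
      have hvb : v ∈ Metric.ball u0 δ := by
        rw [Metric.mem_ball, dist_eq_norm] at hu ⊢
        have := norm_nonneg (u - u0)
        nlinarith
      obtain ⟨b1, b2⟩ := hball v hvb
      refine ⟨(starRingEnd ℂ) (h v), ?_, ?_⟩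
      · rw [Function.iterate_succ_apply', hv1, b1]
      · calc _ ≤ c * ‖v - u0‖ := b2
          _ ≤ c * (c ^ k * ‖u - u0‖) := by gcongr
          _ = _ := by ring
  choose v hv1 hv2 using iter
  have hv : Tendsto v atTop (𝓝 u0) := by
    rw [tendsto_iff_norm_sub_tendsto_zero]
    refine squeeze_zero (fun _ => norm_nonneg _) hv2 ?_
    have := (tendsto_pow_atTop_nhds_zero_of_lt_one hc0 hc2).mul_const ‖u - u0‖
    simpa using this
  have := (hα.continuous.tendsto u0).comp hv
  refine this.congr fun k => ?_
  simp [hv1]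

lemma basin_open {Rh : OnePoint ℂ → OnePoint ℂ} (hRh : Continuous Rh) {x : OnePoint ℂ}
    (hx : basin Rh x ∈ 𝓝 x) : IsOpen (basin Rh x) := by
  rw [isOpen_iff_mem_nhds]
  intro y hy
  obtain ⟨V, hV, hVo, hxV⟩ := mem_nhds_iff.1 hx
  have : ∀ᶠ k in atTop, Rh^[k] y ∈ V := hy.eventually (hVo.mem_nhds hxV)
  obtain ⟨k, hk⟩ := this.exists
  have h1 : Rh^[k] ⁻¹' V ∈ 𝓝 y := (hVo.preimage (hRh.iterate k)).mem_nhds hk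
  filter_upwards [h1] with y' hy'
  exact (basin_inv_iter Rh x y' k).1 (hV hy')

end partP1

section partP2
open Topology Filter

/-- The chart at infinity of the Riemann sphere centred so that it omits `a`. -/
noncomputable def chartA (a u : ℂ) : OnePoint ℂ := open Classical in
  if u = 0 then OnePoint.infty else ((a + u⁻¹ : ℂ) : OnePoint ℂ)

lemma chartA_zero (a : ℂ) : chartA a 0 = OnePoint.infty := by simp [chartA]

lemma chartA_ne {a u : ℂ} (hu : u ≠ 0) : chartA a u = ((a + u⁻¹ : ℂ) : OnePoint ℂ) := by
  simp [chartA, hu]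

lemma chartA_openEmbedding (a : ℂ) : IsOpenEmbedding (chartA a) := by
  let M : OnePoint ℂ → OnePoint ℂ := fun y => OnePoint.elim y ((a : ℂ) : OnePoint ℂ) (chartA a)
  have hcoe : Tendsto ((↑) : ℂ → OnePoint ℂ) (cocompact ℂ) (𝓝 OnePoint.infty) := by
    have := OnePoint.tendsto_coe_infty (X := ℂ)
    simpa [coclosedCompact_eq_cocompact] using this
  have hc : Continuous M := by
    rw [OnePoint.continuous_iff]
    constructor
    · have h1 : Tendsto (fun u : ℂ => a + u⁻¹) (cocompact ℂ) (𝓝 a) := by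
        have : Tendsto (fun u : ℂ => u⁻¹) (cocompact ℂ) (𝓝 0) := by
          rw [← Metric.cobounded_eq_cocompact]
          exact tendsto_inv₀_cobounded
        simpa using this.const_add a
      have h2 : Tendsto (fun u : ℂ => ((a + u⁻¹ : ℂ) : OnePoint ℂ)) (cocompact ℂ) (𝓝 (a : OnePoint ℂ)) :=
        (OnePoint.continuous_coe.tendsto a).comp h1
      rw [coclosedCompact_eq_cocompact]
      refine h2.congr' ?_
      have : ∀ᶠ u : ℂ in cocompact ℂ, u ≠ 0 := by
        have := (isCompact_singleton (x := (0 : ℂ))).compl_mem_cocompact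
        filter_upwards [this] with u hu
        simpa using hu
      filter_upwards [this] with u hu
      change _ = chartA a u
      rw [chartA_ne hu]
    · rw [continuous_iff_continuousAt]
      intro u
      change ContinuousAt (chartA a) u
      by_cases hu : u = 0
      · subst hu
        rw [continuousAt_iff_punctured_nhds, chartA_zero]
        have h1 : Tendsto (fun u : ℂ => a + u⁻¹) (𝓝[≠] 0) (cocompact ℂ) := by
          have : Tendsto (fun u : ℂ => u⁻¹) (𝓝[≠] 0) (cocompact ℂ) := by
            rw [← Metric.cobounded_eq_cocompact]
            exact tendsto_inv₀_nhdsNE_zero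
          exact (Homeomorph.addLeft a).isClosedEmbedding.tendsto_cocompact.comp this
        refine (hcoe.comp h1).congr' ?_
        filter_upwards [self_mem_nhdsWithin] with u hu
        rw [chartA_ne hu]; rfl
      · have h1 : ContinuousAt (fun u : ℂ => ((a + u⁻¹ : ℂ) : OnePoint ℂ)) u := by
          refine OnePoint.continuous_coe.continuousAt.comp ?_
          exact continuousAt_const.add (continuousAt_inv₀ hu)
        refine h1.congr ?_
        filter_upwards [isOpen_ne.mem_nhds hu] with v hv
        rw [chartA_ne hv]
  have hbij : Function.Bijective M := by
    constructor
    · intro x y hxy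
      induction x using OnePoint.rec with
      | infty =>
        induction y using OnePoint.rec with
        | infty => rfl
        | coe y =>
          change ((a : ℂ) : OnePoint ℂ) = chartA a y at hxy
          by_cases hy : y = 0
          · subst hy; rw [chartA_zero] at hxy; exact absurd hxy (OnePoint.coe_ne_infty _)
          · rw [chartA_ne hy, OnePoint.coe_eq_coe] at hxy
            simp [hy] at hxy
      | coe x =>
        induction y using OnePoint.rec with
        | infty =>
          change chartA a x = ((a : ℂ) : OnePoint ℂ) at hxy
          by_cases hy : x = 0
          · subst hy; rw [chartA_zero] at hxy; exact absurd hxy.symm (OnePoint.coe_ne_infty _)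
          · rw [chartA_ne hy, OnePoint.coe_eq_coe] at hxy
            simp [hy] at hxy
        | coe y =>
          change chartA a x = chartA a y at hxy
          by_cases hx : x = 0 <;> by_cases hy : y = 0
          · rw [hx, hy]
          · rw [hx, chartA_zero, chartA_ne hy] at hxy
            exact absurd hxy.symm (OnePoint.coe_ne_infty _)
          · rw [hy, chartA_zero, chartA_ne hx] at hxy
            exact absurd hxy (OnePoint.coe_ne_infty _)
          · rw [chartA_ne hx, chartA_ne hy, OnePoint.coe_eq_coe] at hxy
            rw [inv_injective (add_left_cancel hxy)]
    · intro y
      induction y using OnePoint.rec with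
      | infty => exact ⟨((0 : ℂ) : OnePoint ℂ), chartA_zero a⟩
      | coe y =>
        by_cases hy : y = a
        · exact ⟨OnePoint.infty, by simp [M, hy]⟩
        · refine ⟨(((y - a)⁻¹ : ℂ) : OnePoint ℂ), ?_⟩
          change chartA a _ = _
          rw [chartA_ne (inv_ne_zero (sub_ne_zero.2 hy))]
          simp
  have hM : IsHomeomorph M := isHomeomorph_iff_continuous_bijective.2 ⟨hc, hbij⟩
  exact hM.isOpenEmbedding.comp OnePoint.isOpenEmbedding_coe

lemma hsd_inv {f : ℂ → ℂ} {f' x : ℂ} (h : HasStrictDerivAt f f' x) (hx : f x ≠ 0) :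
    HasStrictDerivAt (fun x => (f x)⁻¹) (-f' / f x ^ 2) x := by
  have h1 : HasStrictDerivAt (fun x => (f x)⁻¹) (-(f x ^ 2)⁻¹ * f') x :=
    (hasStrictDerivAt_inv hx).comp x h
  refine h1.congr_deriv ?_
  ring

lemma hsd_sub_const {f : ℂ → ℂ} {f' x : ℂ} (c : ℂ) (h : HasStrictDerivAt f f' x) :
    HasStrictDerivAt (fun x => f x - c) f' x := by
  have h1 : HasStrictDerivAt (fun x => f x - c) (f' - 0) x :=
    HasStrictDerivAt.sub h (hasStrictDerivAt_const x c)
  simpa using h1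

section lens
variable {n : ℕ} (z : Fin n → ℂ) (m : Fin n → ℝ) (c g : ℂ)

/-- The rational function whose conjugate is iterated. -/
noncomputable def lensr (x : ℂ) : ℂ := c + g * x + ∑ j, (m j : ℂ) / (x - z j)

/-- Its derivative. -/
noncomputable def lensd (x : ℂ) : ℂ := g - ∑ j, (m j : ℂ) / (x - z j) ^ 2

/-- The antiholomorphic map on the sphere. -/
noncomputable def sphR (y : OnePoint ℂ) : OnePoint ℂ := open Classical in
  OnePoint.elim y OnePoint.infty (fun x : ℂ => if ∃ j, x = z j then OnePoint.infty else
    (((starRingEnd ℂ) (lensr z m c g x) : ℂ) : OnePoint ℂ))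

lemma sphR_infty : sphR z m c g OnePoint.infty = OnePoint.infty := rfl

lemma sphR_pole (j : Fin n) : sphR z m c g ((z j : ℂ) : OnePoint ℂ) = OnePoint.infty := by
  simp [sphR]

lemma sphR_coe {x : ℂ} (hx : ∀ j, x ≠ z j) : sphR z m c g (x : OnePoint ℂ) =
    (((starRingEnd ℂ) (lensr z m c g x) : ℂ) : OnePoint ℂ) := by
  simp [sphR, hx]

lemma lensr_hasStrictDerivAt {x : ℂ} (hx : ∀ j, x ≠ z j) :
    HasStrictDerivAt (lensr z m c g) (lensd z m g x) x := by
  unfold lensr lensd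
  have h1 : ∀ j ∈ Finset.univ, HasStrictDerivAt (fun x => (m j : ℂ) / (x - z j))
      (-((m j : ℂ) / (x - z j) ^ 2)) x := by
    intro j _
    have h0 : HasStrictDerivAt (fun x => x - z j) 1 x := (hasStrictDerivAt_id x).sub_const (z j)
    have h1 : HasStrictDerivAt (fun x => (x - z j)⁻¹) (-1 / (x - z j) ^ 2) x :=
      hsd_inv h0 (sub_ne_zero.2 (hx j))
    have h2 : HasStrictDerivAt (fun x => (m j : ℂ) * (x - z j)⁻¹)
      ((m j : ℂ) * (-1 / (x - z j) ^ 2)) x := HasStrictDerivAt.const_mul (m j : ℂ) h1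
    have h3 : HasStrictDerivAt (fun x => (m j : ℂ) / (x - z j))
      ((m j : ℂ) * (-1 / (x - z j) ^ 2)) x := h2
    exact h3.congr_deriv (by ring)
  have h2 := HasStrictDerivAt.fun_sum h1
  have h4 : HasStrictDerivAt (fun x => g * x) (g * 1) x :=
    HasStrictDerivAt.const_mul g (hasStrictDerivAt_id x)
  have h5 : HasStrictDerivAt (fun x => c + g * x) (g * 1) x := HasStrictDerivAt.const_add c h4
  have h3 := HasStrictDerivAt.fun_add h5 h2
  exact h3.congr_deriv (by simp [sub_eq_add_neg])

lemma nonpole_eventually {x : ℂ} (hx : ∀ j, x ≠ z j) : ∀ᶠ y in 𝓝 x, ∀ j, y ≠ z j := by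
  rw [Filter.eventually_all]
  intro j
  exact isOpen_ne.mem_nhds (hx j)

/-- `1 / (r - conj a)`, extended by `0` at the poles. -/
noncomputable def lensk (a x : ℂ) : ℂ := open Classical in
  if ∃ j, x = z j then 0 else (lensr z m c g x - (starRingEnd ℂ) a)⁻¹

lemma lensk_nonpole {a x : ℂ} (hx : ∀ j, x ≠ z j) :
    lensk z m c g a x = (lensr z m c g x - (starRingEnd ℂ) a)⁻¹ := by
  simp [lensk, hx]

lemma lensk_pole {a : ℂ} (j : Fin n) : lensk z m c g a (z j) = 0 := by
  simp [lensk]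

lemma lensk_deriv {a x : ℂ} (hx : ∀ j, x ≠ z j) (ha : lensr z m c g x ≠ (starRingEnd ℂ) a) :
    HasStrictDerivAt (lensk z m c g a)
      (-lensd z m g x / (lensr z m c g x - (starRingEnd ℂ) a) ^ 2) x := by
  have h0 : HasStrictDerivAt (fun x => lensr z m c g x - (starRingEnd ℂ) a) (lensd z m g x) x :=
    hsd_sub_const _ (lensr_hasStrictDerivAt z m c g hx)
  have h1 := hsd_inv h0 (sub_ne_zero.2 ha)
  refine h1.congr_of_eventuallyEq ?_
  filter_upwards [nonpole_eventually z hx] with y hy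
  rw [lensk_nonpole z m c g hy]

lemma lensk_deriv_pole (hz : Function.Injective z) (hm : ∀ j, 0 < m j) {a : ℂ} (j : Fin n) :
    HasStrictDerivAt (lensk z m c g a) (1 / (m j : ℂ)) (z j) := by
  have hmj : (m j : ℂ) ≠ 0 := by exact_mod_cast (hm j).ne'
  let X : ℂ → ℂ := fun x => c + g * x + ∑ i ∈ Finset.univ.erase j, (m i : ℂ) / (x - z i)
    - (starRingEnd ℂ) a
  have hX : ∃ d, HasStrictDerivAt X d (z j) := by
    have h1 : ∀ i ∈ Finset.univ.erase j, HasStrictDerivAt (fun x => (m i : ℂ) / (x - z i))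
        ((m i : ℂ) * (-1 / (z j - z i) ^ 2)) (z j) := by
      intro i hi
      have hne : z j - z i ≠ 0 := sub_ne_zero.2 fun h => (Finset.ne_of_mem_erase hi) (hz h).symm
      have h0 : HasStrictDerivAt (fun x => x - z i) 1 (z j) :=
        (hasStrictDerivAt_id (z j)).sub_const (z i)
      have h1 := hsd_inv h0 hne
      have h2 := HasStrictDerivAt.const_mul (m i : ℂ) h1
      simpa only [div_eq_mul_inv] using h2
    have h2 := HasStrictDerivAt.fun_sum h1
    have h4 : HasStrictDerivAt (fun x => g * x) (g * 1) (z j) :=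
      HasStrictDerivAt.const_mul g (hasStrictDerivAt_id (z j))
    have h5 : HasStrictDerivAt (fun x => c + g * x) (g * 1) (z j) := HasStrictDerivAt.const_add c h4
    exact ⟨_, hsd_sub_const _ (HasStrictDerivAt.fun_add h5 h2)⟩
  obtain ⟨d, hd⟩ := hX
  have h1 : HasStrictDerivAt (fun x => x - z j) 1 (z j) :=
    (hasStrictDerivAt_id (z j)).sub_const (z j)
  have h2 := HasStrictDerivAt.add_const (m j : ℂ) (HasStrictDerivAt.fun_mul h1 hd)
  have h3 := HasStrictDerivAt.fun_div h1 h2 (by simp [hmj])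
  have h4 : HasStrictDerivAt (fun x => (x - z j) / ((x - z j) * X x + m j)) (1 / (m j : ℂ)) (z j) := by
    refine h3.congr_deriv ?_
    simp
    field_simp
  refine h4.congr_of_eventuallyEq ?_
  have hnp : ∀ᶠ y in 𝓝 (z j), ∀ i, i ≠ j → y ≠ z i := by
    rw [Filter.eventually_all]
    intro i
    by_cases hi : i = j
    · simp [hi]
    · filter_upwards [isOpen_ne.mem_nhds (fun h : z j = z i => hi (hz h).symm)] with y hy _
      exact hy
  filter_upwards [hnp] with y hy
  by_cases hyj : y = z j
  · subst hyj; simp [lensk_pole]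
  · have hy' : ∀ i, y ≠ z i := fun i => by
      by_cases hi : i = j
      · rw [hi]; exact hyj
      · exact hy i hi
    rw [lensk_nonpole z m c g hy']
    have hs : y - z j ≠ 0 := sub_ne_zero.2 hyj
    have : lensr z m c g y - (starRingEnd ℂ) a = ((y - z j) * X y + m j) / (y - z j) := by
      simp only [lensr, X]
      rw [← Finset.add_sum_erase _ _ (Finset.mem_univ j)]
      field_simp
      ring
    rw [this, inv_div]

/-- The map in the chart at infinity. -/
noncomputable def lensh (a u : ℂ) : ℂ := open Classical in
  if u = 0 then 0 else lensk z m c g a (a + u⁻¹)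

lemma lensh_zero {a : ℂ} : lensh z m c g a 0 = 0 := by simp [lensh]

lemma lensh_ne {a u : ℂ} (hu : u ≠ 0) : lensh z m c g a u = lensk z m c g a (a + u⁻¹) := by
  simp [lensh, hu]

lemma lensh_deriv_zero (hg : g ≠ 0) {a : ℂ} : HasStrictDerivAt (lensh z m c g a) (1 / g) 0 := by
  let X : ℂ → ℂ := fun u => (c + g * a - (starRingEnd ℂ) a) +
    ∑ i, (m i : ℂ) * u / (1 - (z i - a) * u)
  have hX : ∃ d, HasStrictDerivAt X d 0 := by
    have h1 : ∀ i : Fin n, ∃ d, HasStrictDerivAt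
        (fun u => (m i : ℂ) * u / (1 - (z i - a) * u)) d (0 : ℂ) := by
      intro i
      have e1 : HasStrictDerivAt (fun u => (m i : ℂ) * u) ((m i : ℂ) * 1) 0 :=
        HasStrictDerivAt.const_mul _ (hasStrictDerivAt_id (0 : ℂ))
      have e2 : HasStrictDerivAt (fun u => (z i - a) * u) ((z i - a) * 1) 0 :=
        HasStrictDerivAt.const_mul _ (hasStrictDerivAt_id (0 : ℂ))
      have e3 : HasStrictDerivAt (fun u => 1 - (z i - a) * u) (-((z i - a) * 1)) 0 :=
        HasStrictDerivAt.const_sub 1 e2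
      exact ⟨_, HasStrictDerivAt.fun_div e1 e3 (by simp)⟩
    choose D hD using h1
    have h2 := HasStrictDerivAt.fun_sum (u := Finset.univ) (fun i _ => hD i)
    exact ⟨_, HasStrictDerivAt.const_add _ h2⟩
  obtain ⟨d, hd⟩ := hX
  have h1 : HasStrictDerivAt (fun u : ℂ => u) 1 0 := hasStrictDerivAt_id (0 : ℂ)
  have h2 := HasStrictDerivAt.add_const g (HasStrictDerivAt.fun_mul h1 hd)
  have h3 := HasStrictDerivAt.fun_div h1 h2 (by simp [hg])
  have h4 : HasStrictDerivAt (fun u => u / (u * X u + g)) (1 / g) 0 := by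
    refine h3.congr_deriv ?_
    simp
    field_simp
  refine h4.congr_of_eventuallyEq ?_
  have hnp : ∀ᶠ u in 𝓝 (0 : ℂ), ∀ i, 1 - (z i - a) * u ≠ 0 := by
    rw [Filter.eventually_all]
    intro i
    have : ContinuousAt (fun u => 1 - (z i - a) * u) 0 := by fun_prop
    exact this.eventually_ne (by simp)
  filter_upwards [hnp] with u hu
  by_cases hu0 : u = 0
  · subst hu0; simp [lensh_zero]
  · have e1 : ∀ i, a + u⁻¹ - z i = (1 - (z i - a) * u) / u := fun i => by field_simp; ring
    have hx : ∀ i, a + u⁻¹ ≠ z i := fun i h => by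
      have := e1 i
      rw [h, sub_self] at this
      exact div_ne_zero (hu i) hu0 this.symm
    rw [lensh_ne z m c g hu0, lensk_nonpole z m c g hx]
    have : lensr z m c g (a + u⁻¹) - (starRingEnd ℂ) a = (u * X u + g) / u := by
      simp only [lensr, X, e1]
      have e2 : ∀ i, (m i : ℂ) / ((1 - (z i - a) * u) / u) = (m i : ℂ) * u / (1 - (z i - a) * u) :=
        fun i => by rw [div_div_eq_mul_div]
      simp only [e2]
      field_simp
      ring
    rw [this, inv_div]

lemma sphR_chart {a u : ℂ} (h : sphR z m c g (chartA a u) ≠ (a : OnePoint ℂ)) :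
    sphR z m c g (chartA a u) = chartA a ((starRingEnd ℂ) (lensh z m c g a u)) := by
  by_cases hu : u = 0
  · subst hu; rw [lensh_zero, map_zero, chartA_zero, sphR_infty]
  · rw [chartA_ne hu] at h ⊢
    rw [lensh_ne z m c g hu]
    by_cases hx : ∀ j, a + u⁻¹ ≠ z j
    · rw [lensk_nonpole z m c g hx]
      rw [sphR_coe z m c g hx] at h ⊢
      have h' : (starRingEnd ℂ) (lensr z m c g (a + u⁻¹)) - a ≠ 0 := by
        intro h0
        exact h (by rw [sub_eq_zero.1 h0])
      rw [chartA_ne]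
      · simp
      · simpa using h'
    · push Not at hx
      obtain ⟨j, hj⟩ := hx
      rw [hj, lensk_pole, sphR_pole, map_zero, chartA_zero]

lemma sphR_chart_eventually (hg : g ≠ 0) {a : ℂ} : ∀ᶠ u in 𝓝 (0 : ℂ),
    sphR z m c g (chartA a u) = chartA a ((starRingEnd ℂ) (lensh z m c g a u)) := by
  have h1 := (lensh_deriv_zero z m c g hg (a := a)).hasDerivAt.eventually_ne (c := 0)
    (by simp [hg])
  rw [eventually_nhdsWithin_iff] at h1
  filter_upwards [h1] with u hu
  apply sphR_chart
  by_cases hu0 : u = 0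
  · rw [hu0, chartA_zero, sphR_infty]; exact (OnePoint.coe_ne_infty _).symm
  · have h2 := hu hu0
    rw [lensh_ne z m c g hu0] at h2
    rw [chartA_ne hu0]
    by_cases hx : ∀ j, a + u⁻¹ ≠ z j
    · rw [sphR_coe z m c g hx]
      rw [lensk_nonpole z m c g hx] at h2
      intro h3
      rw [OnePoint.coe_eq_coe] at h3
      apply h2
      have : lensr z m c g (a + u⁻¹) = (starRingEnd ℂ) a := by
        rw [← Complex.conj_conj (lensr z m c g (a + u⁻¹)), h3]
      rw [this]; simp
    · push Not at hx
      obtain ⟨j, hj⟩ := hx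
      rw [hj, sphR_pole]; exact (OnePoint.coe_ne_infty _).symm

lemma sphR_continuous (hz : Function.Injective z) (hm : ∀ j, 0 < m j) (hg : g ≠ 0) :
    Continuous (sphR z m c g) := by
  rw [continuous_iff_continuousAt]
  intro y
  induction y using OnePoint.rec with
  | infty =>
    rw [← chartA_zero 0, ← (chartA_openEmbedding 0).continuousAt_iff]
    have h1 : ContinuousAt (fun u => chartA 0 ((starRingEnd ℂ) (lensh z m c g 0 u))) 0 :=
      (chartA_openEmbedding 0).continuous.continuousAt.comp
        (Complex.continuous_conj.continuousAt.comp
          (lensh_deriv_zero z m c g hg).hasDerivAt.continuousAt)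
    refine h1.congr ?_
    filter_upwards [sphR_chart_eventually z m c g hg (a := 0)] with u hu
    exact hu.symm
  | coe x =>
    rw [OnePoint.continuousAt_coe]
    by_cases hx : ∀ j, x ≠ z j
    · have h1 : ContinuousAt
          (fun x => (((starRingEnd ℂ) (lensr z m c g x) : ℂ) : OnePoint ℂ)) x :=
        OnePoint.continuous_coe.continuousAt.comp (Complex.continuous_conj.continuousAt.comp
          (lensr_hasStrictDerivAt z m c g hx).hasDerivAt.continuousAt)
      refine h1.congr ?_
      filter_upwards [nonpole_eventually z hx] with y hy
      exact (sphR_coe z m c g hy).symm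
    · push Not at hx
      obtain ⟨j, rfl⟩ := hx
      have hk := (lensk_deriv_pole z m c g hz hm (a := 0) j).hasDerivAt
      have h1 : ContinuousAt (fun u => chartA 0 ((starRingEnd ℂ) (lensk z m c g 0 u))) (z j) :=
        (chartA_openEmbedding 0).continuous.continuousAt.comp
          (Complex.continuous_conj.continuousAt.comp hk.continuousAt)
      refine h1.congr ?_
      have h2 := hk.eventually_ne (c := 0) (by simp [(hm j).ne'])
      rw [eventually_nhdsWithin_iff] at h2
      filter_upwards [h2] with y hy
      by_cases hyp : ∀ i, y ≠ z i
      · have h3 := hy (hyp j)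
        simp only [Function.comp, sphR_coe z m c g hyp]
        rw [chartA_ne (by simpa using h3), lensk_nonpole z m c g hyp]
        simp
      · push Not at hyp
        obtain ⟨i, rfl⟩ := hyp
        simp [lensk_pole, chartA_zero, sphR_pole]

lemma basin_nhds_finite {p : ℂ} (hp : ∀ j, p ≠ z j) (hfix : (starRingEnd ℂ) (lensr z m c g p) = p)
    (hlt : ‖lensd z m g p‖ < 1) :
    basin (sphR z m c g) (p : OnePoint ℂ) ∈ 𝓝 (p : OnePoint ℂ) := by
  refine basin_nhds OnePoint.isOpenEmbedding_coe (h := lensr z m c g) ?_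
    (lensr_hasStrictDerivAt z m c g hp).hasDerivAt hlt hfix
  filter_upwards [nonpole_eventually z hp] with y hy
  exact sphR_coe z m c g hy

lemma basin_nhds_infty (hg : 1 < ‖g‖) :
    basin (sphR z m c g) OnePoint.infty ∈ 𝓝 (OnePoint.infty : OnePoint ℂ) := by
  have hg0 : g ≠ 0 := fun h => by simp [h] at hg; linarith
  rw [← chartA_zero 0]
  refine basin_nhds (chartA_openEmbedding 0) (h := lensh z m c g 0)
    (sphR_chart_eventually z m c g hg0) (lensh_deriv_zero z m c g hg0).hasDerivAt ?_ ?_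
  · rw [norm_div, norm_one]
    rw [div_lt_one (by linarith)]; exact hg
  · simp [lensh_zero]

lemma miss_ball {α : ℂ → OnePoint ℂ} (hα : IsOpenEmbedding α) {y0 : OnePoint ℂ}
    (hr : {y0}ᶜ ⊆ Set.range α) {U : Set (OnePoint ℂ)} (hU : IsOpen U) (hne : U.Nonempty) :
    ∃ a : ℂ, ∃ ρ > 0, ∀ u ∈ Metric.ball a ρ, α u ∈ U := by
  have : NeBot (𝓝[≠] y0) := by
    induction y0 using OnePoint.rec with
    | infty => infer_instance
    | coe x => infer_instance
  obtain ⟨y, hy1, hy2⟩ := (dense_compl_singleton y0).inter_open_nonempty U hU hne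
  obtain ⟨a, rfl⟩ := hr hy2
  obtain ⟨ρ, hρ, h⟩ := Metric.isOpen_iff.1 (hU.preimage hα.continuous) a hy1
  exact ⟨a, ρ, hρ, h⟩

lemma crit_in_basin_finite (hz : Function.Injective z) (hm : ∀ j, 0 < m j) (hg : g ≠ 0) {p : ℂ}
    (hp : ∀ j, p ≠ z j) (hfix : (starRingEnd ℂ) (lensr z m c g p) = p)
    (hlt : ‖lensd z m g p‖ < 1) {x : OnePoint ℂ} (hx : x ≠ p) (hxf : sphR z m c g x = x)
    (hxb : basin (sphR z m c g) x ∈ 𝓝 x) :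
    ∃ q : ℂ, (∀ j, q ≠ z j) ∧ lensd z m g q = 0 ∧ (q : OnePoint ℂ) ∈ basin (sphR z m c g) p := by
  by_contra hcon
  push Not at hcon
  have hcont := sphR_continuous z m c g hz hm hg
  have hpfix : sphR z m c g (p : OnePoint ℂ) = p := by rw [sphR_coe z m c g hp, hfix]
  set B := basin (sphR z m c g) (p : OnePoint ℂ) with hB
  have hinf : OnePoint.infty ∉ B := fun h =>
    (OnePoint.coe_ne_infty p) (basin_disj h (basin_self (sphR_infty z m c g)))
  have hpole : ∀ u : ℂ, (u : OnePoint ℂ) ∈ B → ∀ j, u ≠ z j := by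
    intro u hu j hj
    subst hj
    rw [hB, ← basin_inv, sphR_pole] at hu
    exact hinf hu
  obtain ⟨a, ρ, hρ, hball⟩ := miss_ball (OnePoint.isOpenEmbedding_coe (X := ℂ))
    (y0 := OnePoint.infty) (fun y hy => OnePoint.ne_infty_iff_exists.1 hy) (basin_open hcont hxb)
    ⟨x, basin_self hxf⟩
  refine fatou_abs hcont OnePoint.isOpenEmbedding_coe
    (basin_open hcont (basin_nhds_finite z m c g hp hfix hlt)) (basin_inv _ _) ?_
    (h := lensr z m c g) (u0 := p) ?_ ?_ (basin_self hpfix) hfix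
    (lensr_hasStrictDerivAt z m c g hp).hasDerivAt hlt hρ (a := a) ?_
  · intro y hy
    induction y using OnePoint.rec with
    | infty => exact absurd hy hinf
    | coe y => exact ⟨y, rfl⟩
  · intro u hu
    exact sphR_coe z m c g (hpole u hu)
  · intro u hu
    refine ⟨_, ?_, lensr_hasStrictDerivAt z m c g (hpole u hu)⟩
    intro h0
    exact hcon u (hpole u hu) h0 hu
  · intro u hu hu2
    exact hx (basin_disj (hball u hu) hu2)

lemma crit_in_basin_infty (hz : Function.Injective z) (hm : ∀ j, 0 < m j) (hg : 1 < ‖g‖) {p : ℂ}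
    (hp : ∀ j, p ≠ z j) (hfix : (starRingEnd ℂ) (lensr z m c g p) = p)
    (hlt : ‖lensd z m g p‖ < 1) :
    ∃ q : ℂ, (∀ j, q ≠ z j) ∧ lensd z m g q = 0 ∧
      (q : OnePoint ℂ) ∈ basin (sphR z m c g) OnePoint.infty := by
  by_contra hcon
  push Not at hcon
  have hg0 : g ≠ 0 := fun h => by simp [h] at hg; linarith
  have hcont := sphR_continuous z m c g hz hm hg0
  have hpfix : sphR z m c g (p : OnePoint ℂ) = p := by rw [sphR_coe z m c g hp, hfix]
  set B := basin (sphR z m c g) OnePoint.infty with hB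
  have hpB : (p : OnePoint ℂ) ∉ B := fun h =>
    (OnePoint.coe_ne_infty p) (basin_disj (basin_self hpfix) h)
  have hrange : {(p : OnePoint ℂ)}ᶜ ⊆ Set.range (chartA p) := by
    intro y hy
    induction y using OnePoint.rec with
    | infty => exact ⟨0, chartA_zero p⟩
    | coe y =>
      have hyp : y ≠ p := fun h => hy (by simp [h])
      refine ⟨(y - p)⁻¹, ?_⟩
      rw [chartA_ne (inv_ne_zero (sub_ne_zero.2 hyp))]
      simp
  have hbp := basin_nhds_finite z m c g hp hfix hlt
  obtain ⟨a, ρ, hρ, hball⟩ := miss_ball (chartA_openEmbedding p) hrange (basin_open hcont hbp)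
    ⟨p, basin_self hpfix⟩
  have hRne : ∀ u, chartA p u ∈ B → sphR z m c g (chartA p u) ≠ (p : OnePoint ℂ) := by
    intro u hu h
    rw [hB, ← basin_inv, h] at hu
    exact hpB hu
  refine fatou_abs hcont (chartA_openEmbedding p)
    (basin_open hcont (basin_nhds_infty z m c g hg)) (basin_inv _ _) ?_
    (h := lensh z m c g p) (u0 := 0) (d0 := 1 / g) ?_ ?_ ?_ ?_
    (lensh_deriv_zero z m c g hg0).hasDerivAt ?_ hρ (a := a) ?_
  · intro y hy
    apply hrange
    intro h
    rw [Set.mem_singleton_iff] at h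
    rw [h] at hy
    exact hpB hy
  · intro u hu
    exact sphR_chart z m c g (hRne u hu)
  · intro u hu
    by_cases hu0 : u = 0
    · subst hu0
      exact ⟨1 / g, by simp [hg0], lensh_deriv_zero z m c g hg0⟩
    · have hk : ∃ d, d ≠ 0 ∧ HasStrictDerivAt (lensk z m c g p) d (p + u⁻¹) := by
        have hu1 := hRne u hu
        change chartA p u ∈ B at hu
        rw [chartA_ne hu0] at hu hu1
        by_cases hx : ∀ j, p + u⁻¹ ≠ z j
        · have hne : lensr z m c g (p + u⁻¹) ≠ (starRingEnd ℂ) p := by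
            intro h
            rw [sphR_coe z m c g hx, h] at hu1
            simp at hu1
          refine ⟨_, ?_, lensk_deriv z m c g hx hne⟩
          have h1 : lensd z m g (p + u⁻¹) ≠ 0 := fun h0 => hcon _ hx h0 hu
          exact div_ne_zero (neg_ne_zero.2 h1) (pow_ne_zero 2 (sub_ne_zero.2 hne))
        · push Not at hx
          obtain ⟨j, hj⟩ := hx
          rw [hj]
          exact ⟨_, by simp [(hm j).ne'], lensk_deriv_pole z m c g hz hm j⟩
      obtain ⟨d, hd1, hd2⟩ := hk
      have h1 := ((hasStrictDerivAt_inv hu0).const_add p)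
      have h2 := HasStrictDerivAt.comp u hd2 h1
      refine ⟨_, ?_, h2.congr_of_eventuallyEq ?_⟩
      · exact mul_ne_zero hd1 (by simp [hu0])
      · filter_upwards [isOpen_ne.mem_nhds hu0] with v hv
        simp [lensh_ne z m c g hv]
  · change chartA p 0 ∈ B
    rw [chartA_zero]; exact basin_self (sphR_infty z m c g)
  · simp [lensh_zero]
  · rw [norm_div, norm_one]
    rw [div_lt_one (by linarith)]; exact hg
  · intro u hu hu2
    exact (OnePoint.coe_ne_infty p) (basin_disj (hball u hu) hu2)

end lens

end partP2

section partP3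
open Topology Filter

section lens3
variable {n : ℕ} (z : Fin n → ℂ) (m : Fin n → ℝ) (c g : ℂ)

lemma crit_card (hn : 0 < n) (hz : Function.Injective z) (hm : ∀ j, 0 < m j) :
    {q : ℂ | (∀ j, q ≠ z j) ∧ lensd z m g q = 0}.Finite ∧
    {q : ℂ | (∀ j, q ≠ z j) ∧ lensd z m g q = 0}.ncard ≤ 2 * n := by
  classical
  let Q : Polynomial ℂ := Polynomial.C g * ∏ j, (Polynomial.X - Polynomial.C (z j)) ^ 2 -
    ∑ j, Polynomial.C (m j : ℂ) * ∏ i ∈ Finset.univ.erase j, (Polynomial.X - Polynomial.C (z i)) ^ 2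
  have hev : ∀ x, Q.eval x = g * ∏ j, (x - z j) ^ 2 -
      ∑ j, (m j : ℂ) * ∏ i ∈ Finset.univ.erase j, (x - z i) ^ 2 := by
    intro x
    simp [Q, Polynomial.eval_finset_sum, Polynomial.eval_prod]
  have hQ : Q ≠ 0 := by
    intro h
    have h1 := hev (z ⟨0, hn⟩)
    rw [h] at h1
    rw [Finset.prod_eq_zero (Finset.mem_univ ⟨0, hn⟩) (by simp)] at h1
    rw [Finset.sum_eq_single ⟨0, hn⟩] at h1
    · simp only [Polynomial.eval_zero, mul_zero, zero_sub] at h1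
      have h2 := neg_eq_zero.1 h1.symm
      rw [mul_eq_zero] at h2
      rcases h2 with h2 | h2
      · exact (hm _).ne' (by exact_mod_cast h2)
      · rw [Finset.prod_eq_zero_iff] at h2
        obtain ⟨i, hi, h3⟩ := h2
        have h4 := sub_eq_zero.1 (pow_eq_zero_iff (two_ne_zero) |>.1 h3)
        exact (Finset.ne_of_mem_erase hi) (hz h4).symm
    · intro b _ hb
      rw [Finset.prod_eq_zero (i := ⟨0, hn⟩), mul_zero]
      · simp [Ne.symm hb]
      · simp
    · simp
  have hdeg : Q.natDegree ≤ 2 * n := by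
    have hp : ∀ s : Finset (Fin n),
        (∏ i ∈ s, (Polynomial.X - Polynomial.C (z i)) ^ 2).natDegree ≤ 2 * n := by
      intro s
      refine (Polynomial.natDegree_prod_le _ _).trans ?_
      calc _ ≤ ∑ i ∈ s, 2 := by
            apply Finset.sum_le_sum
            intro i _
            refine Polynomial.natDegree_pow_le.trans ?_
            simp
        _ = 2 * s.card := by simp [mul_comm]
        _ ≤ 2 * n := by
            have := Finset.card_le_univ s
            simp at this
            omega
    refine Polynomial.natDegree_sub_le_of_le (m := 2 * n) (n := 2 * n) ?_ ?_ |>.trans (by simp)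
    · exact (Polynomial.natDegree_C_mul_le _ _).trans (hp _)
    · refine Polynomial.natDegree_sum_le_of_forall_le _ _ ?_
      intro j _
      exact (Polynomial.natDegree_C_mul_le _ _).trans (hp _)
  have hsub : {q : ℂ | (∀ j, q ≠ z j) ∧ lensd z m g q = 0} ⊆ (Q.roots.toFinset : Set ℂ) := by
    rintro q ⟨hq, hq0⟩
    simp only [Finset.mem_coe, Multiset.mem_toFinset, Polynomial.mem_roots hQ, Polynomial.IsRoot]
    rw [hev]
    have : g * ∏ j, (q - z j) ^ 2 - ∑ j, (m j : ℂ) * ∏ i ∈ Finset.univ.erase j, (q - z i) ^ 2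
        = (∏ j, (q - z j) ^ 2) * lensd z m g q := by
      rw [lensd, mul_sub, mul_comm g, Finset.mul_sum]
      congr 1
      apply Finset.sum_congr rfl
      intro j _
      rw [← Finset.mul_prod_erase _ _ (Finset.mem_univ j)]
      have := sub_ne_zero.2 (hq j)
      field_simp
    rw [this, hq0, mul_zero]
  refine ⟨(Finset.finite_toSet _).subset hsub, ?_⟩
  calc _ ≤ (Q.roots.toFinset : Set ℂ).ncard := Set.ncard_le_ncard hsub (Finset.finite_toSet _)
    _ = Q.roots.toFinset.card := Set.ncard_coe_finset _
    _ ≤ Multiset.card Q.roots := Multiset.toFinset_card_le _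
    _ ≤ _ := (Polynomial.card_roots' _).trans hdeg

/-- Attracting finite fixed points. -/
def attr : Set ℂ := {p | (∀ j, p ≠ z j) ∧ (starRingEnd ℂ) (lensr z m c g p) = p ∧
    ‖lensd z m g p‖ < 1}

lemma attr_card (hn : 0 < n) (hz : Function.Injective z) (hm : ∀ j, 0 < m j) (hg : g ≠ 0) :
    (attr z m c g).ncard ≤ 2 * n := by
  by_cases h1 : (attr z m c g).ncard ≤ 1
  · omega
  push Not at h1
  obtain ⟨hf, hc⟩ := crit_card z m g hn hz hm
  obtain ⟨p1, hp1, p2, hp2, hne⟩ := (Set.one_lt_ncard_iff_nontrivial_and_finite.1 h1).1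
  have key : ∀ p : ℂ, p ∈ attr z m c g → ∃ q : ℂ, ((∀ j, q ≠ z j) ∧ lensd z m g q = 0) ∧
      (q : OnePoint ℂ) ∈ basin (sphR z m c g) p := by
    intro p hp
    have : ∃ x ∈ attr z m c g, x ≠ p := by
      by_cases h : p1 = p
      · exact ⟨p2, hp2, fun h' => hne (h.trans h'.symm)⟩
      · exact ⟨p1, hp1, h⟩
    obtain ⟨x, hx, hxp⟩ := this
    obtain ⟨q, a, b, c⟩ := crit_in_basin_finite z m c g hz hm hg hp.1 hp.2.1 hp.2.2
      (x := (x : OnePoint ℂ)) (fun h => hxp (OnePoint.coe_eq_coe.1 h))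
      (by rw [sphR_coe z m c g hx.1, hx.2.1])
      (basin_nhds_finite z m c g hx.1 hx.2.1 hx.2.2)
    exact ⟨q, ⟨a, b⟩, c⟩
  choose! f hfa hfb using key
  refine le_trans (Set.ncard_le_ncard_of_injOn f ?_ ?_ hf) hc
  · intro p hp; exact hfa p hp
  · intro p hp p' hp' h
    have h2 := hfb p hp
    rw [h] at h2
    exact OnePoint.coe_eq_coe.1 (basin_disj h2 (hfb p' hp'))

lemma attr_card_big (hn : 2 ≤ n) (hz : Function.Injective z) (hm : ∀ j, 0 < m j) (hg : 1 < ‖g‖) :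
    (attr z m c g).ncard + 1 ≤ 2 * n := by
  by_cases h1 : (attr z m c g).ncard = 0
  · omega
  have hg0 : g ≠ 0 := fun h => by simp [h] at hg; linarith
  obtain ⟨hf, hc⟩ := crit_card z m g (by omega) hz hm
  obtain ⟨p0, hp0⟩ := Set.nonempty_of_ncard_ne_zero h1
  obtain ⟨q0, hq1, hq2, hq3⟩ := crit_in_basin_infty z m c g hz hm hg hp0.1 hp0.2.1 hp0.2.2
  have key : ∀ p : ℂ, p ∈ attr z m c g → ∃ q : ℂ, ((∀ j, q ≠ z j) ∧ lensd z m g q = 0) ∧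
      (q : OnePoint ℂ) ∈ basin (sphR z m c g) p := by
    intro p hp
    obtain ⟨q, a, b, c⟩ := crit_in_basin_finite z m c g hz hm hg0 hp.1 hp.2.1 hp.2.2
      (x := OnePoint.infty) (OnePoint.infty_ne_coe _) (sphR_infty z m c g)
      (basin_nhds_infty z m c g hg)
    exact ⟨q, ⟨a, b⟩, c⟩
  choose! f hfa hfb using key
  have hle : (attr z m c g).ncard ≤
      ({q : ℂ | (∀ j, q ≠ z j) ∧ lensd z m g q = 0} \ {q0}).ncard := by
    refine (Set.ncard_le_ncard_of_injOn f ?_ ?_ hf.diff)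
    · intro p hp
      refine ⟨hfa p hp, ?_⟩
      intro h
      rw [Set.mem_singleton_iff] at h
      have h2 := hfb p hp
      rw [h] at h2
      exact OnePoint.infty_ne_coe _ (basin_disj hq3 h2)
    · intro p hp p' hp' h
      have h2 := hfb p hp
      rw [h] at h2
      exact OnePoint.coe_eq_coe.1 (basin_disj h2 (hfb p' hp'))
  have := Set.ncard_diff_singleton_add_one (s := {q : ℂ | (∀ j, q ≠ z j) ∧ lensd z m g q = 0})
    (a := q0) ⟨hq1, hq2⟩ hf
  omega

end lens3

end partP3

section partP4
open Topology Filter MeasureTheory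

/-- Jacobian determinant of a pair of real functions. -/
noncomputable def jac (U W : ℂ → ℝ) (x : ℂ) : ℝ :=
  fderiv ℝ U x 1 * fderiv ℝ W x Complex.I - fderiv ℝ U x Complex.I * fderiv ℝ W x 1

lemma jac_zero_aux {h W : ℂ → ℝ} (hh : ContDiff ℝ 2 h) (hW : ContDiff ℝ 2 W)
    (hs : HasCompactSupport h) (v w : ℂ) :
    Integrable (fun x => fderiv ℝ h x v * fderiv ℝ W x w) ∧
    ∫ x, fderiv ℝ h x v * fderiv ℝ W x w = - ∫ x, h x * fderiv ℝ (fderiv ℝ W) x v w := by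
  have hW1 : ContDiff ℝ 1 (fderiv ℝ W) := hW.fderiv_right (by norm_num)
  have hh1 : ContDiff ℝ 1 (fderiv ℝ h) := hh.fderiv_right (by norm_num)
  have hg : ContDiff ℝ 1 (fun x => fderiv ℝ W x w) := hW1.clm_apply contDiff_const
  have hder : ∀ x, fderiv ℝ (fun x => fderiv ℝ W x w) x v = fderiv ℝ (fderiv ℝ W) x v w := by
    intro x
    have hd : DifferentiableAt ℝ (fderiv ℝ W) x := hW1.differentiable (by norm_num) x
    rw [fderiv_clm_apply hd (differentiableAt_const w)]
    simp
  have i1 : Integrable (fun x => fderiv ℝ h x v * fderiv ℝ W x w) := by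
    apply Continuous.integrable_of_hasCompactSupport
    · exact (hh1.continuous.clm_apply continuous_const).mul hg.continuous
    · exact (hs.fderiv_apply (𝕜 := ℝ) v).mul_right
  have i2 : Integrable (fun x => h x * fderiv ℝ (fun x => fderiv ℝ W x w) x v) := by
    apply Continuous.integrable_of_hasCompactSupport
    · exact hh.continuous.mul ((hg.continuous_fderiv (by norm_num)).clm_apply continuous_const)
    · exact hs.mul_right
  have i3 : Integrable (fun x => h x * fderiv ℝ W x w) := by
    apply Continuous.integrable_of_hasCompactSupport
    · exact hh.continuous.mul hg.continuous
    · exact hs.mul_right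
  refine ⟨i1, ?_⟩
  have := integral_mul_fderiv_eq_neg_fderiv_mul_of_integrable i1 i2 i3
    (fun x _ => hh.differentiable (by norm_num) x) (fun x _ => hg.differentiable (by norm_num) x)
  simp only [hder] at this
  rw [this, neg_neg]

lemma jac_zero {h W : ℂ → ℝ} (hh : ContDiff ℝ 2 h) (hW : ContDiff ℝ 2 W)
    (hs : HasCompactSupport h) : ∫ x, jac h W x = 0 := by
  obtain ⟨i1, e1⟩ := jac_zero_aux hh hW hs 1 Complex.I
  obtain ⟨i2, e2⟩ := jac_zero_aux hh hW hs Complex.I 1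
  unfold jac
  rw [integral_sub i1 i2, e1, e2]
  have : ∀ x, fderiv ℝ (fderiv ℝ W) x 1 Complex.I = fderiv ℝ (fderiv ℝ W) x Complex.I 1 := by
    intro x
    have : IsSymmSndFDerivAt ℝ W x := hW.contDiffAt.isSymmSndFDerivAt (by simp)
    exact this.eq 1 Complex.I
  simp [this]

lemma jac_integrable {h W : ℂ → ℝ} (hh : ContDiff ℝ 2 h) (hW : ContDiff ℝ 2 W)
    (hs : HasCompactSupport h) : Integrable (jac h W) :=
  (jac_zero_aux hh hW hs 1 Complex.I).1.sub (jac_zero_aux hh hW hs Complex.I 1).1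

lemma jac_anti (U W : ℂ → ℝ) (x : ℂ) : jac U W x = - jac W U x := by
  unfold jac; ring

lemma jac_diff {U0 W0 U1 W1 : ℂ → ℝ} (hU0 : ContDiff ℝ 2 U0) (hW0 : ContDiff ℝ 2 W0)
    (hU1 : ContDiff ℝ 2 U1) (hW1 : ContDiff ℝ 2 W1)
    (hU : HasCompactSupport (U1 - U0)) (hW : HasCompactSupport (W1 - W0))
    (i0 : Integrable (jac U0 W0)) :
    ∫ x, jac U1 W1 x = ∫ x, jac U0 W0 x := by
  have d1 : ContDiff ℝ 2 (U1 - U0) := hU1.sub hU0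
  have d2 : ContDiff ℝ 2 (W1 - W0) := hW1.sub hW0
  have e : ∀ x, jac U1 W1 x = jac U0 W0 x + (jac (U1 - U0) W1 x - jac (W1 - W0) U0 x) := by
    intro x
    have a1 : fderiv ℝ (U1 - U0) x = fderiv ℝ U1 x - fderiv ℝ U0 x :=
      fderiv_sub (hU1.differentiable (by norm_num) x) (hU0.differentiable (by norm_num) x)
    have a2 : fderiv ℝ (W1 - W0) x = fderiv ℝ W1 x - fderiv ℝ W0 x :=
      fderiv_sub (hW1.differentiable (by norm_num) x) (hW0.differentiable (by norm_num) x)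
    unfold jac
    rw [a1, a2]
    simp only [_root_.sub_apply]
    ring
  have j1 := jac_integrable d1 hW1 hU
  have j2 := jac_integrable d2 hU0 hW
  simp only [e]
  have j3 : Integrable (fun x => jac (U1 - U0) W1 x - jac (W1 - W0) U0 x) := j1.sub j2
  rw [integral_add i0 j3, integral_sub j1 j2, jac_zero d1 hW1 hU, jac_zero d2 hU0 hW]
  simp

lemma det_complex (T : ℂ →L[ℝ] ℂ) :
    T.det = (T 1).re * (T Complex.I).im - (T Complex.I).re * (T 1).im := by
  rw [ContinuousLinearMap.det, ← LinearMap.det_toMatrix Complex.basisOneI, Matrix.det_fin_two]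
  simp [LinearMap.toMatrix_apply]

/-- Local degree formula. -/
lemma integral_local {G : ℂ → ℂ} (hG : ContDiff ℝ 2 G) {Z : Finset ℂ}
    (hZ : ∀ x, G x = 0 ↔ x ∈ Z) (hdet : ∀ x ∈ Z, (fderiv ℝ G x).det ≠ 0)
    {R δ : ℝ} (hδ : 0 < δ) (hR : ∀ x, R ≤ ‖x‖ → δ ≤ ‖G x‖) :
    ∃ ε > 0, ∀ k : ℂ → ℝ, Continuous k → (∀ w, ε ≤ ‖w‖ → k w = 0) →
      Integrable (fun x => k (G x) * (fderiv ℝ G x).det) ∧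
      ∫ x, k (G x) * (fderiv ℝ G x).det =
        (∑ p ∈ Z, (SignType.sign (fderiv ℝ G p).det : ℝ)) * ∫ w, k w := by
  classical
  have hG1 : ContDiff ℝ 1 (fderiv ℝ G) := hG.fderiv_right (by norm_num)
  have hdc : Continuous fun x => (fderiv ℝ G x).det :=
    ContinuousLinearMap.continuous_det.comp hG1.continuous
  obtain ⟨T, hT, hTd⟩ := Z.finite_toSet.t2_separation
  have key : ∀ p : ℂ, p ∈ Z → ∃ V : Set ℂ, IsOpen V ∧ p ∈ V ∧ V ⊆ T p ∧ Set.InjOn G V ∧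
      G '' V ∈ 𝓝 (0 : ℂ) ∧ ∀ x ∈ V, SignType.sign (fderiv ℝ G x).det =
        SignType.sign (fderiv ℝ G p).det := by
    intro p hp
    have hs : HasStrictFDerivAt G (fderiv ℝ G p) p :=
      hG.contDiffAt.hasStrictFDerivAt (by norm_num)
    let e := (fderiv ℝ G p).toContinuousLinearEquivOfDetNeZero (hdet p hp)
    have hs' : HasStrictFDerivAt G (e : ℂ →L[ℝ] ℂ) p := by
      rw [ContinuousLinearMap.coe_toContinuousLinearEquivOfDetNeZero]; exact hs
    let Φ := hs'.toOpenPartialHomeomorph G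
    have hsg : ∀ᶠ x in 𝓝 p, SignType.sign (fderiv ℝ G x).det =
        SignType.sign (fderiv ℝ G p).det := by
      rcases lt_or_gt_of_ne (hdet p hp) with h | h
      · filter_upwards [hdc.continuousAt.eventually_lt continuousAt_const h] with x hx
        rw [sign_neg hx, sign_neg h]
      · filter_upwards [continuousAt_const.eventually_lt hdc.continuousAt h] with x hx
        rw [sign_pos hx, sign_pos h]
    obtain ⟨S, hS1, hS2, hS3⟩ := eventually_nhds_iff.1 hsg
    refine ⟨Φ.source ∩ T p ∩ S, (Φ.open_source.inter (hT p).2).inter hS2,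
      ⟨⟨hs'.mem_toOpenPartialHomeomorph_source, (hT p).1⟩, hS3⟩,
      fun x hx => hx.1.2, ?_, ?_, fun x hx => hS1 x hx.2⟩
    · have := Φ.injOn
      exact this.mono fun x hx => hx.1.1
    · have h1 : Φ.source ∩ T p ∩ S ∈ 𝓝 p :=
        ((Φ.open_source.inter (hT p).2).inter hS2).mem_nhds
          ⟨⟨hs'.mem_toOpenPartialHomeomorph_source, (hT p).1⟩, hS3⟩
      have h2 := hs'.map_nhds_eq_of_equiv
      have h3 : G '' (Φ.source ∩ T p ∩ S) ∈ map G (𝓝 p) := image_mem_map h1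
      rw [h2, (hZ p).2 hp] at h3
      exact h3
  choose! V hVo hpV hVT hVi hVn hVs using key
  -- lower bound off the union
  have hUo : IsOpen (⋃ p ∈ Z, V p) := isOpen_biUnion fun p hp => hVo p hp
  have hcpt : IsCompact (Metric.closedBall (0 : ℂ) R \ ⋃ p ∈ Z, V p) :=
    (isCompact_closedBall 0 R).diff hUo
  have hlow : ∃ ε1 > 0, ∀ x, x ∉ (⋃ p ∈ Z, V p) → ε1 ≤ ‖G x‖ := by
    rcases (Metric.closedBall (0 : ℂ) R \ ⋃ p ∈ Z, V p).eq_empty_or_nonempty with h | h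
    · refine ⟨δ, hδ, fun x hx => ?_⟩
      apply hR
      by_contra h'
      have : x ∈ Metric.closedBall (0 : ℂ) R \ ⋃ p ∈ Z, V p :=
        ⟨by simp; linarith, hx⟩
      rw [h] at this
      exact this
    · obtain ⟨x0, hx0, hmin⟩ := hcpt.exists_isMinOn h hG.continuous.norm.continuousOn
      have hpos : 0 < ‖G x0‖ := by
        rw [norm_pos_iff]
        intro h0
        have := (hZ x0).1 h0
        exact hx0.2 (Set.mem_biUnion this (hpV x0 this))
      refine ⟨min δ ‖G x0‖, lt_min hδ hpos, fun x hx => ?_⟩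
      by_cases hxR : R ≤ ‖x‖
      · exact (min_le_left _ _).trans (hR x hxR)
      · refine (min_le_right _ _).trans (hmin ⟨?_, hx⟩)
        simp; linarith
  obtain ⟨ε1, hε1, hlow⟩ := hlow
  have himg : (⋂ p ∈ Z, G '' V p) ∈ 𝓝 (0 : ℂ) :=
    (Filter.biInter_finset_mem Z).2 fun p hp => hVn p hp
  obtain ⟨ε2, hε2, hball⟩ := Metric.mem_nhds_iff.1 himg
  refine ⟨min δ (min ε1 ε2), lt_min hδ (lt_min hε1 hε2), fun k hkc hk0 => ?_⟩
  have hk : ∀ w, min ε1 ε2 ≤ ‖w‖ → k w = 0 := fun w hw => hk0 w ((min_le_right _ _).trans hw)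
  have hzero : ∀ x, x ∉ (⋃ p ∈ Z, V p) → k (G x) * (fderiv ℝ G x).det = 0 := by
    intro x hx
    rw [hk _ ((min_le_left _ _).trans (hlow x hx)), zero_mul]
  have hcont : Continuous fun x => k (G x) * (fderiv ℝ G x).det :=
    (hkc.comp hG.continuous).mul hdc
  have hintg : Integrable fun x => k (G x) * (fderiv ℝ G x).det := by
    apply hcont.integrable_of_hasCompactSupport
    refine HasCompactSupport.of_support_subset_isCompact (isCompact_closedBall 0 R) ?_
    intro x hx
    by_contra h
    have h' : R < ‖x‖ := by simpa using h
    exact hx (by simp only [hk0 _ ((min_le_left _ _).trans (hR x h'.le)), zero_mul])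
  refine ⟨hintg, ?_⟩
  rw [← setIntegral_eq_integral_of_forall_compl_eq_zero hzero]
  rw [integral_biUnion_finset Z (fun p hp => (hVo p hp).measurableSet) ?_
    (fun p hp => hintg.integrableOn), Finset.sum_mul]
  · apply Finset.sum_congr rfl
    intro p hp
    have h1 := integral_image_eq_integral_abs_det_fderiv_smul (volume : Measure ℂ)
      (hVo p hp).measurableSet (f := G) (f' := fderiv ℝ G)
      (fun x _ => (hG.differentiable (by norm_num) x).hasFDerivAt.hasFDerivWithinAt)
      (hVi p hp) k
    have h2 : ∫ w in G '' V p, k w = ∫ w, k w := by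
      apply setIntegral_eq_integral_of_forall_compl_eq_zero
      intro w hw
      apply hk
      by_contra hlt
      push Not at hlt
      apply hw
      have : w ∈ ⋂ p ∈ Z, G '' V p := hball (by simpa using hlt.trans_le (min_le_right _ _))
      exact Set.mem_iInter₂.1 this p hp
    rw [← h2, h1, ← integral_const_mul]
    apply setIntegral_congr_fun (hVo p hp).measurableSet
    intro x hx
    have h3 := hVs p hp x hx
    have h4 : (fderiv ℝ G x).det = SignType.sign (fderiv ℝ G x).det * |(fderiv ℝ G x).det| :=
      (sign_mul_abs _).symm
    simp only [smul_eq_mul]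
    rw [← h3]
    conv_lhs => rw [h4]
    ring
  · intro p hp q hq hpq
    exact (hTd hp hq hpq).mono (hVT p hp) (hVT q hq)

lemma jac_comp {A : ℝ → ℝ} (hA : Differentiable ℝ A) {G : ℂ → ℂ} (hG : Differentiable ℝ G) (x : ℂ) :
    jac (fun x => A (G x).re) (fun x => A (G x).im) x =
      (deriv A (G x).re * deriv A (G x).im) * (fderiv ℝ G x).det := by
  have h0 := (hG x).hasFDerivAt
  have h1 : HasFDerivAt (fun x => (G x).re) (Complex.reCLM.comp (fderiv ℝ G x)) x :=
    Complex.reCLM.hasFDerivAt.comp x h0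
  have h2 : HasFDerivAt (fun x => (G x).im) (Complex.imCLM.comp (fderiv ℝ G x)) x :=
    Complex.imCLM.hasFDerivAt.comp x h0
  have h3 := (hA (G x).re).hasDerivAt.comp_hasFDerivAt x h1
  have h4 := (hA (G x).im).hasDerivAt.comp_hasFDerivAt x h2
  have h3' : fderiv ℝ (fun x => A (G x).re) x = _ := h3.fderiv
  have h4' : fderiv ℝ (fun x => A (G x).im) x = _ := h4.fderiv
  rw [det_complex]
  unfold jac
  rw [h3', h4']
  simp
  ring

lemma degree_eq {G0 G1 : ℂ → ℂ} (hG0 : ContDiff ℝ 2 G0) (hG1 : ContDiff ℝ 2 G1) {Z0 Z1 : Finset ℂ}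
    (hZ0 : ∀ x, G0 x = 0 ↔ x ∈ Z0) (hdet0 : ∀ x ∈ Z0, (fderiv ℝ G0 x).det ≠ 0)
    (hZ1 : ∀ x, G1 x = 0 ↔ x ∈ Z1) (hdet1 : ∀ x ∈ Z1, (fderiv ℝ G1 x).det ≠ 0)
    {R δ : ℝ} (hδ : 0 < δ) (hR : ∀ x, R ≤ ‖x‖ → δ ≤ ‖G0 x‖) (heq : ∀ x, R ≤ ‖x‖ → G1 x = G0 x) :
    (∑ p ∈ Z0, (SignType.sign (fderiv ℝ G0 p).det : ℝ)) =
      ∑ p ∈ Z1, (SignType.sign (fderiv ℝ G1 p).det : ℝ) := by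
  obtain ⟨ε0, hε0, H0⟩ := integral_local hG0 hZ0 hdet0 hδ hR
  obtain ⟨ε1, hε1, H1⟩ := integral_local hG1 hZ1 hdet1 hδ (R := R)
    (fun x hx => by rw [heq x hx]; exact hR x hx)
  obtain ⟨ε, hε, he0, he1⟩ : ∃ ε : ℝ, 0 < ε ∧ 2 * ε ≤ ε0 ∧ 2 * ε ≤ ε1 :=
    ⟨min ε0 ε1 / 2, by positivity, by linarith [min_le_left ε0 ε1], by linarith [min_le_right ε0 ε1]⟩
  let A : ℝ → ℝ := fun s => Real.smoothTransition ((s + ε) / (2 * ε))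
  have hA : ContDiff ℝ 2 A := by
    apply (Real.smoothTransition.contDiff (n := 2)).comp
    fun_prop
  have hAmono : Monotone A := by
    intro s t hst
    apply Real.smoothTransition.monotone
    gcongr
  have hA1 : ∀ s, ε ≤ s → A s = 1 := by
    intro s hs
    apply Real.smoothTransition.one_of_one_le
    rw [le_div_iff₀ (by positivity)]; linarith
  have hA0 : ∀ s, s ≤ -ε → A s = 0 := by
    intro s hs
    apply Real.smoothTransition.zero_of_nonpos
    apply div_nonpos_of_nonpos_of_nonneg <;> linarith
  have hd0 : ∀ s, ε ≤ |s| → deriv A s = 0 := by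
    intro s hs
    rcases le_abs.1 hs with h | h
    · apply IsLocalMax.deriv_eq_zero
      apply Filter.Eventually.of_forall
      intro t
      rw [hA1 s h]
      exact Real.smoothTransition.le_one _
    · apply IsLocalMin.deriv_eq_zero
      apply Filter.Eventually.of_forall
      intro t
      rw [hA0 s (by linarith)]
      exact Real.smoothTransition.nonneg _
  have hdc : Continuous (deriv A) := hA.continuous_deriv (by norm_num)
  have hAd : Differentiable ℝ A := hA.differentiable (by norm_num)
  obtain ⟨s, hs1, hs2⟩ := exists_deriv_eq_slope A (show -ε < ε by linarith)
    hA.continuous.continuousOn hAd.differentiableOn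
  have hs0 : deriv A s ≠ 0 := by
    rw [hs2, hA1 ε le_rfl, hA0 (-ε) le_rfl]
    have : ε - -ε ≠ 0 := by linarith
    exact div_ne_zero (by norm_num) this
  let k : ℂ → ℝ := fun w => deriv A w.re * deriv A w.im
  have hkc : Continuous k :=
    (hdc.comp Complex.continuous_re).mul (hdc.comp Complex.continuous_im)
  have hk0 : ∀ w, 2 * ε ≤ ‖w‖ → k w = 0 := by
    intro w hw
    have := Complex.norm_le_abs_re_add_abs_im w
    by_cases h : ε ≤ |w.re|
    · simp [k, hd0 _ h]
    · simp [k, hd0 w.im (by linarith)]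
  have hkpos : 0 < ∫ w, k w := by
    refine hkc.integral_pos_of_hasCompactSupport_nonneg_nonzero (x := (⟨s, s⟩ : ℂ)) ?_ ?_ ?_
    · refine HasCompactSupport.of_support_subset_isCompact (isCompact_closedBall 0 (2 * ε)) ?_
      intro x hx
      by_contra h
      have h' : 2 * ε < ‖x‖ := by simpa using h
      exact hx (hk0 x h'.le)
    · intro w
      exact mul_nonneg hAmono.deriv_nonneg hAmono.deriv_nonneg
    · exact mul_ne_zero hs0 hs0
  obtain ⟨i0, e0⟩ := H0 k hkc fun w hw => hk0 w (he0.trans hw)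
  obtain ⟨i1, e1⟩ := H1 k hkc fun w hw => hk0 w (he1.trans hw)
  have j0 := fun x => jac_comp hAd (hG0.differentiable (by norm_num)) x
  have j1 := fun x => jac_comp hAd (hG1.differentiable (by norm_num)) x
  have cs : ∀ f0 f1 : ℂ → ℝ, (∀ x, R ≤ ‖x‖ → f1 x = f0 x) → HasCompactSupport (f1 - f0) := by
    intro f0 f1 h
    refine HasCompactSupport.of_support_subset_isCompact (isCompact_closedBall 0 R) ?_
    intro x hx
    by_contra h'
    have h2 : R < ‖x‖ := by simpa using h'
    exact hx (by simp [h x h2.le])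
  have hre : ∀ G : ℂ → ℂ, ContDiff ℝ 2 G → ContDiff ℝ 2 (fun x => A (G x).re) := fun G hG =>
    hA.comp (Complex.reCLM.contDiff.comp hG)
  have him : ∀ G : ℂ → ℂ, ContDiff ℝ 2 G → ContDiff ℝ 2 (fun x => A (G x).im) := fun G hG =>
    hA.comp (Complex.imCLM.contDiff.comp hG)
  have i0' : Integrable (jac (fun x => A (G0 x).re) (fun x => A (G0 x).im)) := by
    refine i0.congr (Filter.Eventually.of_forall fun x => ?_)
    exact (j0 x).symm
  have := jac_diff (hre G0 hG0) (him G0 hG0) (hre G1 hG1) (him G1 hG1)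
    (cs _ _ fun x hx => by rw [heq x hx]) (cs _ _ fun x hx => by rw [heq x hx]) i0'
  simp only [j0, j1] at this
  have h : (∫ x, k (G1 x) * (fderiv ℝ G1 x).det) = ∫ x, k (G0 x) * (fderiv ℝ G0 x).det := this
  rw [e0, e1] at h
  exact (mul_right_cancel₀ hkpos.ne' h).symm

end partP4

section partP6
open Topology Filter

section lens6
variable {n : ℕ} (z : Fin n → ℂ) (m : Fin n → ℝ) (c g : ℂ)

/-- Finite fixed points (the images). -/
def imgs : Set ℂ := {p | (∀ j, p ≠ z j) ∧ (starRingEnd ℂ) (lensr z m c g p) = p}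

lemma imgs_finite (hn : 0 < n) (hz : Function.Injective z) (hm : ∀ j, 0 < m j) (hg : g ≠ 0) :
    (imgs z m c g).Finite := by
  classical
  let S : Polynomial ℂ := ∏ j, (Polynomial.X - Polynomial.C (z j))
  let P : Polynomial ℂ := (Polynomial.C c + Polynomial.C g * Polynomial.X) * S +
    ∑ j, Polynomial.C (m j : ℂ) * ∏ i ∈ Finset.univ.erase j, (Polynomial.X - Polynomial.C (z i))
  let b : Fin n → Polynomial ℂ := fun j => P - Polynomial.C ((starRingEnd ℂ) (z j)) * S
  let Q : Polynomial ℂ := (Polynomial.C ((starRingEnd ℂ) c) * S + Polynomial.C ((starRingEnd ℂ) g) * P)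
      * ∏ j, b j + S ^ 2 * ∑ j, Polynomial.C (m j : ℂ) * ∏ i ∈ Finset.univ.erase j, b i
      - Polynomial.X * S * ∏ j, b j
  have hS : ∀ x, S.eval x = ∏ j, (x - z j) := fun x => by simp [S, Polynomial.eval_prod]
  have hP : ∀ x, P.eval x = (c + g * x) * S.eval x +
      ∑ j, (m j : ℂ) * ∏ i ∈ Finset.univ.erase j, (x - z i) := fun x => by
    simp [P, Polynomial.eval_finsetSum, Polynomial.eval_prod]
  have hb : ∀ x j, (b j).eval x = P.eval x - (starRingEnd ℂ) (z j) * S.eval x := fun x j => by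
    simp [b]
  have hQ : ∀ x, Q.eval x = ((starRingEnd ℂ) c * S.eval x + (starRingEnd ℂ) g * P.eval x)
      * ∏ j, (b j).eval x + S.eval x ^ 2 * ∑ j, (m j : ℂ) * ∏ i ∈ Finset.univ.erase j, (b i).eval x
      - x * S.eval x * ∏ j, (b j).eval x := fun x => by
    simp [Q, Polynomial.eval_finsetSum, Polynomial.eval_prod]
  have hQ0 : Q ≠ 0 := by
    intro h
    have h1 := hQ (z ⟨0, hn⟩)
    have hS0 : S.eval (z ⟨0, hn⟩) = 0 := by
      rw [hS]; exact Finset.prod_eq_zero (Finset.mem_univ ⟨0, hn⟩) (by simp)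
    have hP0 : P.eval (z ⟨0, hn⟩) ≠ 0 := by
      rw [hP, hS0, mul_zero, zero_add, Finset.sum_eq_single ⟨0, hn⟩]
      · refine mul_ne_zero (by exact_mod_cast (hm _).ne') (Finset.prod_ne_zero_iff.2 ?_)
        intro i hi
        exact sub_ne_zero.2 fun h => (Finset.ne_of_mem_erase hi) (hz h).symm
      · intro b _ hb
        rw [Finset.prod_eq_zero (i := ⟨0, hn⟩), mul_zero]
        · simp [Ne.symm hb]
        · simp
      · simp
    simp only [h, hb, hS0] at h1
    simp [hg, hP0] at h1
  refine (Q.roots.toFinset.finite_toSet).subset ?_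
  rintro x ⟨hx, hfix⟩
  simp only [Finset.mem_coe, Multiset.mem_toFinset, Polynomial.mem_roots hQ0, Polynomial.IsRoot]
  have hSx : S.eval x ≠ 0 := by
    rw [hS]; exact Finset.prod_ne_zero_iff.2 fun j _ => sub_ne_zero.2 (hx j)
  set w := (starRingEnd ℂ) x with hw
  have hr : lensr z m c g x = w := by
    rw [hw, ← hfix, Complex.conj_conj, hfix]
  have hPx : P.eval x = S.eval x * w := by
    rw [hP, ← hr, lensr, mul_add, Finset.mul_sum, mul_comm (c + g * x)]
    congr 1
    apply Finset.sum_congr rfl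
    intro j _
    rw [hS, ← Finset.mul_prod_erase _ _ (Finset.mem_univ j)]
    have := sub_ne_zero.2 (hx j)
    field_simp
  have hbx : ∀ j, (b j).eval x = S.eval x * (w - (starRingEnd ℂ) (z j)) := fun j => by
    rw [hb, hPx]; ring
  have hwz : ∀ j, w - (starRingEnd ℂ) (z j) ≠ 0 := fun j => by
    rw [hw, ← map_sub]
    exact (map_ne_zero _).2 (sub_ne_zero.2 (hx j))
  have hxe : x = (starRingEnd ℂ) c + (starRingEnd ℂ) g * w +
      ∑ j, (m j : ℂ) / (w - (starRingEnd ℂ) (z j)) := by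
    conv_lhs => rw [← hfix]
    simp [lensr, hw]
  have hsum : S.eval x ^ 2 * ∑ j, (m j : ℂ) * ∏ i ∈ Finset.univ.erase j, (b i).eval x =
      S.eval x * (∏ j, (b j).eval x) * ∑ j, (m j : ℂ) / (w - (starRingEnd ℂ) (z j)) := by
    rw [Finset.mul_sum, Finset.mul_sum]
    apply Finset.sum_congr rfl
    intro j _
    rw [← Finset.mul_prod_erase _ _ (Finset.mem_univ j), hbx j]
    have := hwz j
    field_simp
  rw [hQ, hsum, hPx]
  conv_lhs => enter [2, 1, 1]; rw [hxe]
  ring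

end lens6

end partP6

section partP5
open Topology Filter

lemma det_conj_lin (T : ℂ →L[ℝ] ℂ) (s d : ℂ) (hT : ∀ h, T h = s * (h - (starRingEnd ℂ) (d * h))) :
    T.det = ‖s‖ ^ 2 * (1 - ‖d‖ ^ 2) := by
  rw [det_complex, hT, hT, ← Complex.normSq_eq_norm_sq, ← Complex.normSq_eq_norm_sq,
    Complex.normSq_apply, Complex.normSq_apply]
  simp
  ring

lemma det_conj_lin' (T : ℂ →L[ℝ] ℂ) (s : ℂ) (hT : ∀ h, T h = s * (starRingEnd ℂ) h) :
    T.det = - ‖s‖ ^ 2 := by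
  rw [det_complex, hT, hT, ← Complex.normSq_eq_norm_sq, Complex.normSq_apply]
  simp
  ring

lemma deg_app {F : ℂ → ℂ} (hF : ContDiff ℝ 2 F) {N : ℕ} (hN : 1 ≤ N) {c : ℂ} (hc : c ≠ 0)
    {ρ : ℝ} (hρ : ∀ x, ρ ≤ ‖x‖ → ∃ w : ℂ, 0 < w.re ∧ F x = c * (starRingEnd ℂ) x ^ N * w)
    {Z : Finset ℂ} (hZ : ∀ x, F x = 0 ↔ x ∈ Z) (hdet : ∀ x ∈ Z, (fderiv ℝ F x).det ≠ 0) :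
    ∑ p ∈ Z, (SignType.sign (fderiv ℝ F p).det : ℝ) = -N := by
  classical
  let F0 : ℂ → ℂ := fun x => c * ((starRingEnd ℂ) x ^ N - 1)
  have hconj : ContDiff ℝ 2 (fun x : ℂ => (starRingEnd ℂ) x) := Complex.conjCLE.contDiff
  have hF0 : ContDiff ℝ 2 F0 := contDiff_const.mul ((hconj.pow N).sub contDiff_const)
  let Z0 := Polynomial.nthRootsFinset N (1 : ℂ)
  have hZ0 : ∀ x, F0 x = 0 ↔ x ∈ Z0 := by
    intro x
    rw [Polynomial.mem_nthRootsFinset (by omega)]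
    simp only [F0, mul_eq_zero, hc, false_or, sub_eq_zero]
    rw [← map_pow]
    constructor
    · intro h
      have := congrArg (starRingEnd ℂ) h
      simpa using this
    · intro h; rw [h, map_one]
  have hcard : Z0.card = N :=
    (Complex.isPrimitiveRoot_exp N (by omega)).card_nthRootsFinset
  have hdet0 : ∀ x ∈ Z0, (fderiv ℝ F0 x).det < 0 := by
    intro x hx
    have hx0 : x ≠ 0 := by
      rintro rfl
      rw [← hZ0] at hx
      simp [F0, hc, show N ≠ 0 by omega] at hx
    have h1 : HasFDerivAt (fun x : ℂ => (starRingEnd ℂ) x) (Complex.conjCLE : ℂ →L[ℝ] ℂ) x :=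
      Complex.conjCLE.hasFDerivAt
    have h2 := ((h1.pow N).sub_const (1 : ℂ)).const_mul c
    have h3 : fderiv ℝ F0 x = _ := h2.fderiv
    rw [det_conj_lin' (fderiv ℝ F0 x) (c * N * (starRingEnd ℂ) x ^ (N - 1))]
    · have : 0 < ‖c * N * (starRingEnd ℂ) x ^ (N - 1)‖ := by
        rw [norm_pos_iff]
        refine mul_ne_zero (mul_ne_zero hc ?_) (pow_ne_zero _ ?_)
        · exact_mod_cast (show N ≠ 0 by omega)
        · exact (map_ne_zero _).2 hx0
      have := pow_pos this 2
      linarith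
    · intro h
      rw [h3]
      simp
      ring
  let r : ℝ := max ρ 2
  have hr2 : 2 ≤ r := le_max_right _ _
  let χ : ContDiffBump (0 : ℂ) := ⟨r, r + 1, by linarith, by linarith⟩
  let G1 : ℂ → ℂ := fun x => (χ x : ℂ) * F x + (1 - (χ x : ℂ)) * F0 x
  have hχ : ContDiff ℝ 2 (fun x => (χ x : ℂ)) :=
    Complex.ofRealCLM.contDiff.comp (χ.contDiff (n := 2))
  have hG1 : ContDiff ℝ 2 G1 := (hχ.mul hF).add ((contDiff_const.sub hχ).mul hF0)
  have hF0w : ∀ x : ℂ, r ≤ ‖x‖ → ∃ w : ℂ, 0 < w.re ∧ F0 x = c * (starRingEnd ℂ) x ^ N * w := by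
    intro x hx
    have hx0 : x ≠ 0 := by
      rintro rfl
      simp at hx; linarith
    have hp : (starRingEnd ℂ) x ^ N ≠ 0 := pow_ne_zero _ ((map_ne_zero _).2 hx0)
    refine ⟨1 - ((starRingEnd ℂ) x ^ N)⁻¹, ?_, ?_⟩
    · have : ‖((starRingEnd ℂ) x ^ N)⁻¹‖ < 1 := by
        rw [norm_inv, norm_pow, Complex.norm_conj]
        apply inv_lt_one_of_one_lt₀
        exact one_lt_pow₀ (by linarith) (by omega)
      have := Complex.re_le_norm (((starRingEnd ℂ) x ^ N)⁻¹)
      simp only [Complex.sub_re, Complex.one_re]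
      linarith
    · simp only [F0]
      field_simp
  have hG1ne : ∀ x : ℂ, r ≤ ‖x‖ → G1 x ≠ 0 := by
    intro x hx
    obtain ⟨w, hw, e⟩ := hρ x ((le_max_left _ _).trans hx)
    obtain ⟨w0, hw0, e0⟩ := hF0w x hx
    have hx0 : x ≠ 0 := by
      rintro rfl
      simp at hx; linarith
    have : G1 x = c * (starRingEnd ℂ) x ^ N * ((χ x : ℂ) * w + (1 - (χ x : ℂ)) * w0) := by
      simp only [G1]; rw [e, e0]; ring
    rw [this]
    refine mul_ne_zero (mul_ne_zero hc (pow_ne_zero _ ((map_ne_zero _).2 hx0))) ?_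
    intro h
    have h1 := congrArg Complex.re h
    simp at h1
    have a1 := χ.nonneg (x := x)
    have a2 := χ.le_one (x := x)
    have : 0 < χ x * w.re + (1 - χ x) * w0.re := by
      rcases a1.eq_or_lt with h | h
      · rw [← h]; simpa using hw0
      · have := mul_pos h hw
        have := mul_nonneg (sub_nonneg.2 a2) hw0.le
        linarith
    linarith
  have hGF : ∀ x : ℂ, ‖x‖ < r → G1 =ᶠ[𝓝 x] F := by
    intro x hx
    have : Metric.ball (0 : ℂ) r ∈ 𝓝 x := Metric.isOpen_ball.mem_nhds (by simpa using hx)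
    filter_upwards [this] with y hy
    have : χ y = 1 := χ.one_of_mem_closedBall (Metric.ball_subset_closedBall hy)
    simp [G1, this]
  have hFne : ∀ x : ℂ, r ≤ ‖x‖ → F x ≠ 0 := by
    intro x hx
    obtain ⟨w, hw, e⟩ := hρ x ((le_max_left _ _).trans hx)
    have hx0 : x ≠ 0 := by
      rintro rfl
      simp at hx; linarith
    rw [e]
    refine mul_ne_zero (mul_ne_zero hc (pow_ne_zero _ ((map_ne_zero _).2 hx0))) ?_
    rintro rfl; simp at hw
  have hZlt : ∀ x ∈ Z, ‖x‖ < r := by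
    intro x hx
    by_contra h
    exact hFne x (not_lt.1 h) ((hZ x).2 hx)
  have hZ1 : ∀ x, G1 x = 0 ↔ x ∈ Z := by
    intro x
    by_cases h : r ≤ ‖x‖
    · constructor
      · intro h'; exact absurd h' (hG1ne x h)
      · intro h'; have := hZlt x h'; linarith
    · rw [(hGF x (not_le.1 h)).self_of_nhds, hZ]
  have hder : ∀ x ∈ Z, fderiv ℝ G1 x = fderiv ℝ F x := fun x hx => (hGF x (hZlt x hx)).fderiv_eq
  have := degree_eq hF0 hG1 hZ0 (fun x hx => (hdet0 x hx).ne) hZ1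
    (fun x hx => by rw [hder x hx]; exact hdet x hx) (R := r + 1) (δ := ‖c‖)
    (norm_pos_iff.2 hc) ?_ ?_
  · have e1 : ∑ p ∈ Z, (SignType.sign (fderiv ℝ F p).det : ℝ) =
        ∑ p ∈ Z, (SignType.sign (fderiv ℝ G1 p).det : ℝ) :=
      Finset.sum_congr rfl (fun x hx => by rw [hder x hx])
    rw [e1, ← this, Finset.sum_congr rfl (fun x hx => by rw [sign_neg (hdet0 x hx)])]
    simp [hcard]
  · intro x hx
    simp only [F0, norm_mul]
    have h1 : 2 ≤ ‖(starRingEnd ℂ) x ^ N‖ := by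
      rw [norm_pow, Complex.norm_conj]
      calc (2 : ℝ) ≤ ‖x‖ := by linarith
        _ ≤ ‖x‖ ^ N := le_self_pow₀ (by linarith) (by omega)
    have h2 := norm_sub_norm_le ((starRingEnd ℂ) x ^ N) 1
    rw [norm_one] at h2
    have := norm_nonneg c
    nlinarith
  · intro x hx
    have : χ x = 0 := χ.zero_of_le_dist (by simpa using hx)
    simp [G1, this]

end partP5

section partP5b
open Topology Filter

section lens5
variable {n : ℕ} (z : Fin n → ℂ) (m : Fin n → ℝ) (c g : ℂ)

/-- The lens equation with cleared denominators. -/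
noncomputable def lensF (x : ℂ) : ℂ :=
  (∏ j, ((starRingEnd ℂ) x - (starRingEnd ℂ) (z j))) *
    (x - (starRingEnd ℂ) g * (starRingEnd ℂ) x - (starRingEnd ℂ) c) -
  ∑ j, (m j : ℂ) * ∏ i ∈ Finset.univ.erase j, ((starRingEnd ℂ) x - (starRingEnd ℂ) (z i))

lemma lensF_contDiff : ContDiff ℝ 2 (lensF z m c g) := by
  have hconj : ContDiff ℝ 2 (fun x : ℂ => (starRingEnd ℂ) x) := Complex.conjCLE.contDiff
  unfold lensF
  refine ContDiff.sub (ContDiff.mul ?_ ?_) ?_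
  · exact contDiff_prod fun j _ => hconj.sub contDiff_const
  · exact (contDiff_id.sub (contDiff_const.mul hconj)).sub contDiff_const
  · refine ContDiff.sum fun j _ => contDiff_const.mul ?_
    exact contDiff_prod fun j _ => hconj.sub contDiff_const

lemma conj_sub_ne {x a : ℂ} (h : x ≠ a) : (starRingEnd ℂ) x - (starRingEnd ℂ) a ≠ 0 := by
  rw [← map_sub]
  exact (map_ne_zero _).2 (sub_ne_zero.2 h)

lemma lensF_nonpole {x : ℂ} (hx : ∀ j, x ≠ z j) : lensF z m c g x =
    (∏ j, ((starRingEnd ℂ) x - (starRingEnd ℂ) (z j))) *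
      (x - (starRingEnd ℂ) (lensr z m c g x)) := by
  have e : (starRingEnd ℂ) (lensr z m c g x) = (starRingEnd ℂ) c + (starRingEnd ℂ) g *
      (starRingEnd ℂ) x + ∑ j, (m j : ℂ) / ((starRingEnd ℂ) x - (starRingEnd ℂ) (z j)) := by
    simp [lensr]
  have hs : ∑ j, (m j : ℂ) * ∏ i ∈ Finset.univ.erase j, ((starRingEnd ℂ) x - (starRingEnd ℂ) (z i))
      = (∏ j, ((starRingEnd ℂ) x - (starRingEnd ℂ) (z j))) *
        ∑ j, (m j : ℂ) / ((starRingEnd ℂ) x - (starRingEnd ℂ) (z j)) := by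
    rw [Finset.mul_sum]
    apply Finset.sum_congr rfl
    intro j _
    rw [← Finset.mul_prod_erase _ _ (Finset.mem_univ j)]
    have := conj_sub_ne (hx j)
    field_simp
  rw [lensF, hs, e]
  ring

lemma lensF_zero (hz : Function.Injective z) (hm : ∀ j, 0 < m j) (x : ℂ) :
    lensF z m c g x = 0 ↔ x ∈ imgs z m c g := by
  classical
  by_cases hx : ∀ j, x ≠ z j
  · rw [lensF_nonpole z m c g hx, mul_eq_zero, or_iff_right]
    · rw [sub_eq_zero]
      exact ⟨fun h => ⟨hx, h.symm⟩, fun h => h.2.symm⟩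
    · exact Finset.prod_ne_zero_iff.2 fun j _ => conj_sub_ne (hx j)
  · constructor
    · push Not at hx
      obtain ⟨j, rfl⟩ := hx
      intro h
      exfalso
      rw [lensF, Finset.prod_eq_zero (Finset.mem_univ j) (by simp), zero_mul, zero_sub,
        neg_eq_zero, Finset.sum_eq_single j] at h
      · refine mul_ne_zero (by exact_mod_cast (hm _).ne') (Finset.prod_ne_zero_iff.2 ?_) h
        intro i hi
        exact conj_sub_ne fun h => (Finset.ne_of_mem_erase hi) (hz h).symm
      · intro b _ hb
        rw [Finset.prod_eq_zero (i := j), mul_zero]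
        · simp [Ne.symm hb]
        · simp
      · simp
    · intro h; exact absurd h.1 hx

lemma lensF_det {x : ℂ} (hx : x ∈ imgs z m c g) : (fderiv ℝ (lensF z m c g) x).det =
    ‖∏ j, ((starRingEnd ℂ) x - (starRingEnd ℂ) (z j))‖ ^ 2 * (1 - ‖lensd z m g x‖ ^ 2) := by
  apply det_conj_lin
  intro h
  have hconj : ContDiff ℝ 2 (fun x : ℂ => (starRingEnd ℂ) x) := Complex.conjCLE.contDiff
  have hS : DifferentiableAt ℝ (fun x : ℂ => ∏ j, ((starRingEnd ℂ) x - (starRingEnd ℂ) (z j))) x := by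
    have : ContDiff ℝ 2 (fun x : ℂ => ∏ j, ((starRingEnd ℂ) x - (starRingEnd ℂ) (z j))) :=
      contDiff_prod fun j _ => hconj.sub contDiff_const
    exact this.differentiable (by norm_num) x
  have h1 : HasFDerivAt (lensr z m c g) _ x :=
    (lensr_hasStrictDerivAt z m c g hx.1).hasDerivAt.hasFDerivAt.restrictScalars ℝ
  have h2 := (Complex.conjCLE.hasFDerivAt (x := lensr z m c g x)).comp x h1
  have h3 := (hasFDerivAt_id (𝕜 := ℝ) x).sub h2
  have h4 := hS.hasFDerivAt.mul h3
  have h5 : lensF z m c g =ᶠ[𝓝 x] (fun x => (∏ j, ((starRingEnd ℂ) x - (starRingEnd ℂ) (z j))) *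
      (x - (starRingEnd ℂ) (lensr z m c g x))) := by
    filter_upwards [nonpole_eventually z hx.1] with y hy
    exact lensF_nonpole z m c g hy
  rw [(h4.congr_of_eventuallyEq h5).fderiv]
  have h6 := hx.2
  simp [h6]
  left
  ring

lemma lensF_asymp : Tendsto (fun x => lensF z m c g x / ((starRingEnd ℂ) x ^ n * x) -
    (1 - (starRingEnd ℂ) g * ((starRingEnd ℂ) x / x))) (cocompact ℂ) (𝓝 0) := by
  classical
  have hinv : Tendsto (fun x : ℂ => x⁻¹) (cocompact ℂ) (𝓝 0) := by
    rw [← Metric.cobounded_eq_cocompact]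
    exact tendsto_inv₀_cobounded
  have hcinv : Tendsto (fun x : ℂ => ((starRingEnd ℂ) x)⁻¹) (cocompact ℂ) (𝓝 0) := by
    have := (Complex.continuous_conj.tendsto 0).comp hinv
    simpa [Function.comp_def] using this
  have hq1 : ∀ j, Tendsto (fun x : ℂ => 1 - (starRingEnd ℂ) (z j) * ((starRingEnd ℂ) x)⁻¹)
      (cocompact ℂ) (𝓝 1) := by
    intro j
    have := (hcinv.const_mul ((starRingEnd ℂ) (z j))).const_sub 1
    simpa using this
  have hq : ∀ s : Finset (Fin n), Tendsto (fun x : ℂ => ∏ j ∈ s,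
      (1 - (starRingEnd ℂ) (z j) * ((starRingEnd ℂ) x)⁻¹)) (cocompact ℂ) (𝓝 1) := by
    intro s
    have := tendsto_finsetProd s (fun j _ => hq1 j)
    simpa using this
  have hbd : IsBoundedUnder (· ≤ ·) (cocompact ℂ)
      ((fun y => ‖y‖) ∘ fun x : ℂ => (1 - (starRingEnd ℂ) g * ((starRingEnd ℂ) x / x))) := by
    refine isBoundedUnder_of ⟨1 + ‖g‖, fun x => ?_⟩
    simp only [Function.comp]
    refine (norm_sub_le _ _).trans ?_
    rw [norm_mul, norm_div, Complex.norm_conj, Complex.norm_conj, norm_one]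
    have := mul_le_mul_of_nonneg_left (div_self_le_one ‖x‖) (norm_nonneg g)
    linarith
  have t1 : Tendsto (fun x : ℂ => (∏ j, (1 - (starRingEnd ℂ) (z j) * ((starRingEnd ℂ) x)⁻¹) - 1) *
      (1 - (starRingEnd ℂ) g * ((starRingEnd ℂ) x / x))) (cocompact ℂ) (𝓝 0) := by
    have h0 := (hq Finset.univ).sub_const 1
    rw [sub_self] at h0
    exact h0.zero_mul_isBoundedUnder_le hbd
  have t2 : Tendsto (fun x : ℂ => (∏ j, (1 - (starRingEnd ℂ) (z j) * ((starRingEnd ℂ) x)⁻¹)) *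
      ((starRingEnd ℂ) c * x⁻¹)) (cocompact ℂ) (𝓝 0) := by
    have := (hq Finset.univ).mul (hinv.const_mul ((starRingEnd ℂ) c))
    simpa using this
  have t3 : Tendsto (fun x : ℂ => ∑ j, (m j : ℂ) * (∏ i ∈ Finset.univ.erase j,
      (1 - (starRingEnd ℂ) (z i) * ((starRingEnd ℂ) x)⁻¹)) * (((starRingEnd ℂ) x)⁻¹ * x⁻¹))
      (cocompact ℂ) (𝓝 0) := by
    have := tendsto_finsetSum Finset.univ (fun j _ =>
      ((hq (Finset.univ.erase j)).const_mul (m j : ℂ)).mul (hcinv.mul hinv))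
    simpa using this
  have t4 := (t1.sub t2).sub t3
  rw [sub_zero, sub_zero] at t4
  refine t4.congr' ?_
  have : ∀ᶠ u : ℂ in cocompact ℂ, u ≠ 0 := by
    have := (isCompact_singleton (x := (0 : ℂ))).compl_mem_cocompact
    filter_upwards [this] with u hu
    simpa using hu
  filter_upwards [this] with x hx
  have hy : (starRingEnd ℂ) x ≠ 0 := (map_ne_zero _).2 hx
  set y := (starRingEnd ℂ) x with hyd
  have e1 : ∀ s : Finset (Fin n), ∏ j ∈ s, (y - (starRingEnd ℂ) (z j)) =
      y ^ s.card * ∏ j ∈ s, (1 - (starRingEnd ℂ) (z j) * y⁻¹) := by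
    intro s
    rw [← Finset.prod_const, ← Finset.prod_mul_distrib]
    apply Finset.prod_congr rfl
    intro j _
    field_simp
  have e2 : ∑ j, (m j : ℂ) * (∏ i ∈ Finset.univ.erase j,
      (1 - (starRingEnd ℂ) (z i) * y⁻¹)) * (y⁻¹ * x⁻¹) =
      (∑ j, (m j : ℂ) * ∏ i ∈ Finset.univ.erase j, (y - (starRingEnd ℂ) (z i))) / (y ^ n * x) := by
    rw [Finset.sum_div]
    apply Finset.sum_congr rfl
    intro j _
    rw [e1]
    have : (Finset.univ.erase j).card + 1 = n := by
      rw [Finset.card_erase_add_one (Finset.mem_univ j)]; simp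
    have hp : y ^ n = y ^ (Finset.univ.erase j).card * y := by rw [← pow_succ, this]
    rw [hp]
    field_simp
  rw [e2, lensF, ← hyd, e1 Finset.univ, Finset.card_univ, Fintype.card_fin]
  generalize (∏ j, (1 - (starRingEnd ℂ) (z j) * y⁻¹)) = q
  generalize (∑ j, (m j : ℂ) * ∏ i ∈ Finset.univ.erase j, (y - (starRingEnd ℂ) (z i))) = s
  field_simp
  ring

lemma lensF_small (hn : 1 ≤ n) (hg : ‖g‖ < 1) : ∃ ρ : ℝ, ∀ x, ρ ≤ ‖x‖ → ∃ w : ℂ, 0 < w.re ∧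
    lensF z m c g x = 1 * (starRingEnd ℂ) x ^ (n - 1) * w := by
  have h := (lensF_asymp z m c g).eventually (Metric.ball_mem_nhds 0 (sub_pos.2 hg))
  rw [← Metric.cobounded_eq_cocompact] at h
  obtain ⟨ρ, hρ⟩ := (Metric.hasBasis_cobounded_compl_closedBall (0 : ℂ)).eventually_iff.1 h
  refine ⟨max 1 (ρ + 1), fun x hx => ?_⟩
  have hx1 : 1 ≤ ‖x‖ := (le_max_left _ _).trans hx
  have hx2 : ρ + 1 ≤ ‖x‖ := (le_max_right _ _).trans hx
  have hx0 : x ≠ 0 := by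
    rintro rfl
    simp at hx1; linarith
  have hy : (starRingEnd ℂ) x ≠ 0 := (map_ne_zero _).2 hx0
  have h1 := hρ.2 (x := x) (by simp; linarith)
  set H := lensF z m c g x / ((starRingEnd ℂ) x ^ n * x) with hH
  have hre : 0 < H.re := by
    have h2 : ‖H - 1‖ < 1 := by
      have e : H - 1 = (H - (1 - (starRingEnd ℂ) g * ((starRingEnd ℂ) x / x))) -
        (starRingEnd ℂ) g * ((starRingEnd ℂ) x / x) := by ring
      rw [e]
      refine (norm_sub_le _ _).trans_lt ?_
      rw [norm_mul, norm_div, Complex.norm_conj, Complex.norm_conj,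
        div_self (norm_ne_zero_iff.2 hx0)]
      rw [dist_zero_right] at h1
      linarith
    have := (abs_lt.1 ((Complex.abs_re_le_norm (H - 1)).trans_lt h2)).1
    simp at this
    exact this
  refine ⟨((starRingEnd ℂ) x * x) * H, ?_, ?_⟩
  · rw [mul_comm ((starRingEnd ℂ) x), Complex.mul_conj, Complex.re_ofReal_mul]
    exact mul_pos (Complex.normSq_pos.2 hx0) hre
  · rw [hH]
    have hp : (starRingEnd ℂ) x ^ n = (starRingEnd ℂ) x ^ (n - 1) * (starRingEnd ℂ) x := by
      rw [← pow_succ]; congr 1; omega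
    rw [hp]
    field_simp

lemma lensF_big (hg : 1 < ‖g‖) : ∃ ρ : ℝ, ∀ x, ρ ≤ ‖x‖ → ∃ w : ℂ, 0 < w.re ∧
    lensF z m c g x = (-(starRingEnd ℂ) g) * (starRingEnd ℂ) x ^ (n + 1) * w := by
  have hg0 : g ≠ 0 := fun h => by simp [h] at hg; linarith
  have hgc : (starRingEnd ℂ) g ≠ 0 := (map_ne_zero _).2 hg0
  have h := (lensF_asymp z m c g).eventually (Metric.ball_mem_nhds 0 (sub_pos.2 hg))
  rw [← Metric.cobounded_eq_cocompact] at h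
  obtain ⟨ρ, hρ⟩ := (Metric.hasBasis_cobounded_compl_closedBall (0 : ℂ)).eventually_iff.1 h
  refine ⟨max 1 (ρ + 1), fun x hx => ?_⟩
  have hx1 : 1 ≤ ‖x‖ := (le_max_left _ _).trans hx
  have hx2 : ρ + 1 ≤ ‖x‖ := (le_max_right _ _).trans hx
  have hx0 : x ≠ 0 := by
    rintro rfl
    simp at hx1; linarith
  have hy : (starRingEnd ℂ) x ≠ 0 := (map_ne_zero _).2 hx0
  have h1 := hρ.2 (x := x) (by simp; linarith)
  set H := lensF z m c g x / ((starRingEnd ℂ) x ^ n * x) with hH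
  set K := H * (x / (-(starRingEnd ℂ) g * (starRingEnd ℂ) x)) with hK
  have hre : 0 < K.re := by
    have h2 : ‖K - 1‖ < 1 := by
      have e : K - 1 = ((H - (1 - (starRingEnd ℂ) g * ((starRingEnd ℂ) x / x))) + 1) *
         (x / (-(starRingEnd ℂ) g * (starRingEnd ℂ) x)) := by
        rw [hK]; field_simp; ring
      rw [e, norm_mul, norm_div, norm_mul, norm_neg, Complex.norm_conj, Complex.norm_conj]
      rw [dist_zero_right] at h1
      have h3 := norm_add_le (H - (1 - (starRingEnd ℂ) g * ((starRingEnd ℂ) x / x))) 1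
      rw [norm_one] at h3
      have h4 : ‖x‖ / (‖g‖ * ‖x‖) = 1 / ‖g‖ := by
        field_simp
      rw [h4, mul_one_div, div_lt_one (by linarith)]
      linarith
    have := (abs_lt.1 ((Complex.abs_re_le_norm (K - 1)).trans_lt h2)).1
    simp at this
    exact this
  refine ⟨K, hre, ?_⟩
  rw [hK, hH]
  field_simp
  ring

lemma imgs_regular (hz : Function.Injective z) (hm : ∀ j, 0 < m j) {N : ℕ} (hN : 1 ≤ N) {b : ℂ}
    (hb : b ≠ 0) (hn : 0 < n) (hg : g ≠ 0)
    (hρ : ∃ ρ : ℝ, ∀ x, ρ ≤ ‖x‖ → ∃ w : ℂ, 0 < w.re ∧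
      lensF z m c g x = b * (starRingEnd ℂ) x ^ N * w)
    (hreg : ∀ x ∈ imgs z m c g, ‖lensd z m g x‖ ≠ 1) :
    (imgs z m c g).ncard = 2 * (attr z m c g).ncard + N := by
  classical
  have hfin := imgs_finite z m c g hn hz hm hg
  obtain ⟨ρ, hρ⟩ := hρ
  let Z := hfin.toFinset
  have hZ : ∀ x, x ∈ Z ↔ x ∈ imgs z m c g := fun x => hfin.mem_toFinset
  have hSpos : ∀ x ∈ imgs z m c g,
      0 < ‖∏ j, ((starRingEnd ℂ) x - (starRingEnd ℂ) (z j))‖ ^ 2 := by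
    intro x hx
    have := Finset.prod_ne_zero_iff.2 fun j (_ : j ∈ Finset.univ) => conj_sub_ne (hx.1 j)
    positivity
  have hsg : ∀ x ∈ Z, (SignType.sign (fderiv ℝ (lensF z m c g) x).det : ℝ) =
      if ‖lensd z m g x‖ < 1 then 1 else -1 := by
    intro x hx
    rw [hZ] at hx
    rw [lensF_det z m c g hx]
    have h0 := norm_nonneg (lensd z m g x)
    split_ifs with h
    · rw [sign_pos]
      · rfl
      · exact mul_pos (hSpos x hx) (by nlinarith)
    · rw [sign_neg]
      · simp
      · have h1 : 1 < ‖lensd z m g x‖ := lt_of_le_of_ne (not_lt.1 h) (hreg x hx).symm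
        exact mul_neg_of_pos_of_neg (hSpos x hx) (by nlinarith)
  have hd := deg_app (lensF_contDiff z m c g) hN hb hρ (Z := Z)
    (fun x => (lensF_zero z m c g hz hm x).trans (hZ x).symm) ?_
  · rw [Finset.sum_congr rfl hsg, Finset.sum_ite] at hd
    simp at hd
    have hA : attr z m c g = ((Z.filter fun x => ‖lensd z m g x‖ < 1 : Finset ℂ) : Set ℂ) := by
      ext x
      simp only [Finset.coe_filter, hZ, Set.mem_ofPred_eq]
      exact ⟨fun h => ⟨⟨h.1, h.2.1⟩, h.2.2⟩, fun h => ⟨h.1.1, h.1.2, h.2⟩⟩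
    have hI : (imgs z m c g).ncard = Z.card := Set.ncard_eq_toFinset_card _ hfin
    rw [hA, Set.ncard_coe_finset, hI]
    have h1 := Finset.card_filter_add_card_filter_not (s := Z) (fun x => ‖lensd z m g x‖ < 1)
    simp only [not_lt] at h1 hd
    have h2 : ((Z.filter fun x => ‖lensd z m g x‖ < 1).card : ℝ) + N =
      ((Z.filter fun x => 1 ≤ ‖lensd z m g x‖).card : ℝ) := by linarith
    have h3 : (Z.filter fun x => ‖lensd z m g x‖ < 1).card + N =
      (Z.filter fun x => 1 ≤ ‖lensd z m g x‖).card := by exact_mod_cast h2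
    omega
  · intro x hx h0
    have h1 := hsg x hx
    rw [h0] at h1
    simp at h1
    split_ifs at h1 <;> norm_num at h1

lemma imgs_regular_bound (hn : 2 ≤ n) (hz : Function.Injective z) (hm : ∀ j, 0 < m j) (hg : g ≠ 0)
    (hg1 : ‖g‖ ≠ 1) (hreg : ∀ x ∈ imgs z m c g, ‖lensd z m g x‖ ≠ 1) :
    (imgs z m c g).ncard ≤ 5 * n - 1 := by
  rcases lt_or_gt_of_ne hg1 with h | h
  · have h1 := imgs_regular z m c g hz hm (N := n - 1) (by omega) one_ne_zero (by omega) hg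
      (lensF_small z m c g (by omega) h) hreg
    have h2 := attr_card z m c g (by omega) hz hm hg
    omega
  · have h1 := imgs_regular z m c g hz hm (N := n + 1) (by omega)
      (neg_ne_zero.2 ((map_ne_zero _).2 hg)) (by omega) hg
      (lensF_big z m c g h) hreg
    have h2 := attr_card_big z m c g hn hz hm h
    omega

end lens5

end partP5b

section partP7
open Topology Filter

lemma one_side {C : ℂ → ℝ} {ε : NNReal} {r : ℝ}
    (hC : LipschitzOnWith ε C (Metric.ball 0 r)) (h0 : C 0 = 0) {s0 : ℝ} 
    (hs : |s0| < r / 2) (hCs : C s0 ≠ 0) :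
    ∀ᶠ w : ℂ in 𝓝 0, ε * ‖w‖ < |w.re| → ∃ e : ℝ, (e = 1 ∨ e = -1) ∧ ∃ τ : ℝ, 0 < τ ∧ τ ≤ 1 ∧
      C (((τ * s0 : ℝ) : ℂ) + ((e * w.im : ℝ) : ℂ) * Complex.I) = e * w.re := by
  have hr : 0 < r := by have := abs_nonneg s0; linarith
  have hc0 : 0 < |C s0| := abs_pos.2 hCs
  have ev1 : ∀ᶠ w : ℂ in 𝓝 0, ‖w‖ < r / 2 :=
    (continuous_norm.tendsto (0 : ℂ)).eventually (gt_mem_nhds (by simpa using hr))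
  have ev2 : ∀ᶠ w : ℂ in 𝓝 0, (ε + 1) * ‖w‖ < |C s0| :=
    ((continuous_const.mul continuous_norm).tendsto (0 : ℂ)).eventually
      (gt_mem_nhds (by simpa using hc0))
  filter_upwards [ev1, ev2] with w h1 h2 h3
  have hre : 0 < |w.re| := lt_of_le_of_lt (by positivity) h3
  have him := Complex.abs_im_le_norm w
  have hrn := Complex.abs_re_le_norm w
  -- sign of the target
  obtain ⟨σ, hσ, hσC⟩ : ∃ σ : ℝ, (σ = 1 ∨ σ = -1) ∧ σ * C s0 = |C s0| := by
    rcases abs_choice (C s0) with h | h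
    · exact ⟨1, Or.inl rfl, by rw [one_mul, h]⟩
    · exact ⟨-1, Or.inr rfl, by rw [h]; ring⟩
  obtain ⟨κ, hκ, hκC⟩ : ∃ σ : ℝ, (σ = 1 ∨ σ = -1) ∧ σ * w.re = |w.re| := by
    rcases abs_choice (w.re) with h | h
    · exact ⟨1, Or.inl rfl, by rw [one_mul, h]⟩
    · exact ⟨-1, Or.inr rfl, by rw [h]; ring⟩
  have hσ2 : σ * σ = 1 := by rcases hσ with rfl | rfl <;> norm_num
  have hσa : |σ| = 1 := by rcases hσ with rfl | rfl <;> norm_num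
  have he : σ * κ = 1 ∨ σ * κ = -1 := by
    rcases hσ with rfl | rfl <;> rcases hκ with rfl | rfl <;> norm_num
  have hea : |σ * κ| = 1 := by rcases he with h | h <;> rw [h] <;> norm_num
  refine ⟨σ * κ, he, ?_⟩
  set e := σ * κ with hed
  set y : ℝ → ℂ := fun τ => ((τ * s0 : ℝ) : ℂ) + ((e * w.im : ℝ) : ℂ) * Complex.I with hy
  have hvn : ‖((e * w.im : ℝ) : ℂ) * Complex.I‖ = |w.im| := by
    rw [norm_mul, Complex.norm_I, mul_one, Complex.norm_real, Real.norm_eq_abs, abs_mul, hea, one_mul]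
  have hyb : ∀ τ ∈ Set.Icc (0 : ℝ) 1, y τ ∈ Metric.ball (0 : ℂ) r := by
    intro τ hτ
    rw [mem_ball_zero_iff]
    refine (norm_add_le _ _).trans_lt ?_
    rw [hvn, Complex.norm_real, Real.norm_eq_abs, abs_mul, abs_of_nonneg hτ.1]
    have := mul_le_of_le_one_left (abs_nonneg s0) hτ.2
    linarith
  have hycont : Continuous y := by
    simp only [hy]; fun_prop
  have hf : ContinuousOn (fun τ => σ * C (y τ)) (Set.Icc 0 1) :=
    continuousOn_const.mul (hC.continuousOn.comp hycont.continuousOn hyb)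
  have hs0b : (s0 : ℂ) ∈ Metric.ball (0 : ℂ) r := by
    rw [mem_ball_zero_iff, Complex.norm_real, Real.norm_eq_abs]; linarith
  have ha : σ * C (y 0) < |w.re| := by
    have := hC.dist_le_mul (y 0) (hyb 0 (by simp)) 0 (Metric.mem_ball_self hr)
    rw [h0, Real.dist_eq, sub_zero, dist_zero_right] at this
    have e0 : ‖y 0‖ = |w.im| := by simp only [hy]; rw [zero_mul, Complex.ofReal_zero, zero_add, hvn]
    rw [e0] at this
    calc σ * C (y 0) ≤ |σ * C (y 0)| := le_abs_self _
      _ = |C (y 0)| := by rw [abs_mul, hσa, one_mul]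
      _ ≤ ε * |w.im| := this
      _ ≤ ε * ‖w‖ := by gcongr
      _ < _ := h3
  have hb : |w.re| ≤ σ * C (y 1) := by
    have := hC.dist_le_mul (y 1) (hyb 1 (by simp)) s0 hs0b
    rw [Real.dist_eq, dist_eq_norm] at this
    have e0 : ‖y 1 - s0‖ = |w.im| := by
      simp only [hy]; rw [one_mul, add_sub_cancel_left, hvn]
    rw [e0] at this
    have h5 : |σ * C (y 1) - σ * C s0| ≤ ε * ‖w‖ := by
      rw [← mul_sub, abs_mul, hσa, one_mul]
      exact this.trans (by gcongr)
    rw [hσC] at h5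
    have := (abs_le.1 h5).1
    nlinarith
  obtain ⟨τ, hτ, hτe⟩ := intermediate_value_Icc (zero_le_one) hf ⟨ha.le, hb⟩
  simp only at hτe
  refine ⟨τ, lt_of_le_of_ne hτ.1 ?_, hτ.2, ?_⟩
  · rintro rfl
    exact ha.ne hτe
  · change C (y τ) = _
    calc C (y τ) = σ * (σ * C (y τ)) := by rw [← mul_assoc, hσ2, one_mul]
      _ = _ := by rw [hτe, ← hκC, hed]; ring

lemma fold_local {E : ℂ → ℂ} {T : ℂ →L[ℝ] ℂ} (hE : HasStrictFDerivAt E T 0)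
    (hT : ∀ k, T k = ((2 * k.im : ℝ) : ℂ) * Complex.I) (hE0 : E 0 = 0)
    (hiso : ∀ᶠ x in 𝓝 (0 : ℂ), E x = 0 → x = 0) {ε : ℝ} (hε : 0 < ε) {U : Set ℂ} (hU : U ∈ 𝓝 0) :
    ∀ᶠ w : ℂ in 𝓝 0, ε * ‖w‖ < |w.re| → ∃ q₁ q₂ : ℝ × ℂ, q₁ ≠ q₂ ∧ ∀ q, (q = q₁ ∨ q = q₂) →
      (q.1 = 1 ∨ q.1 = -1) ∧ q.2 ∈ U ∧ E q.2 = q.1 * w := by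
  let T1 : ℂ →L[ℝ] ℂ := Complex.ofRealCLM.comp Complex.reCLM +
    (Complex.ofRealCLM.comp (Complex.imCLM.comp T)).smulRight Complex.I
  have hT1 : ∀ k, T1 k = (k.re : ℂ) + ((2 * k.im : ℝ) : ℂ) * Complex.I := by
    intro k
    simp [T1, hT]
  have hdet : T1.det ≠ 0 := by
    rw [det_complex, hT1, hT1]; simp
  let T2 := T1.toContinuousLinearEquivOfDetNeZero hdet
  have hΨ : HasStrictFDerivAt (fun k => (k.re : ℂ) + ((E k).im : ℂ) * Complex.I) (T2 : ℂ →L[ℝ] ℂ) 0 := by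
    have a1 : HasStrictFDerivAt (fun k : ℂ => ((k.re : ℝ) : ℂ)) (Complex.ofRealCLM.comp Complex.reCLM) 0 :=
      (Complex.ofRealCLM.comp Complex.reCLM).hasStrictFDerivAt
    have a2 : HasStrictFDerivAt (fun k : ℂ => (((E k).im : ℝ) : ℂ))
        (Complex.ofRealCLM.comp (Complex.imCLM.comp T)) 0 := 
      (Complex.ofRealCLM.comp Complex.imCLM).hasStrictFDerivAt.comp 0 hE
    have a3 := a1.add (a2.mul_const Complex.I)
    refine a3.congr_fderiv ?_
    ext k <;> simp [T2, T1, mul_comm]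
  set Ψ : ℂ → ℂ := fun k => (k.re : ℂ) + ((E k).im : ℂ) * Complex.I with hΨd
  have hΨ0 : Ψ 0 = 0 := by simp [hΨd, hE0]
  set Φ := hΨ.localInverse Ψ T2 0 with hΦd
  have hΦr : ∀ᶠ y in 𝓝 (0 : ℂ), Ψ (Φ y) = y := by
    have := hΨ.eventually_right_inverse
    rwa [hΨ0] at this
  have hΦ' : HasStrictFDerivAt Φ (T2.symm : ℂ →L[ℝ] ℂ) 0 := by
    have := hΨ.to_localInverse
    rwa [hΨ0] at this
  have hΦ0 : Φ 0 = 0 := by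
    have := hΨ.localInverse_apply_image
    rwa [hΨ0] at this
  have hΦc : Tendsto Φ (𝓝 0) (𝓝 0) := by
    have := hΦ'.continuousAt.tendsto
    rwa [hΦ0] at this
  set C : ℂ → ℝ := fun y => (E (Φ y)).re with hCd
  have hC' : HasStrictFDerivAt C (0 : ℂ →L[ℝ] ℝ) 0 := by
    have b1 : HasStrictFDerivAt E T (Φ 0) := by rwa [hΦ0]
    have b2 := Complex.reCLM.hasStrictFDerivAt.comp (0 : ℂ) (b1.comp (0 : ℂ) hΦ')
    refine b2.congr_fderiv ?_
    ext k <;> simp [hT]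
  obtain ⟨V, hV, hL⟩ := hC'.exists_lipschitzOnWith_of_nnnorm_lt ⟨ε, hε.le⟩
    (by rw [nnnorm_zero]; exact hε)
  have hC0 : C 0 = 0 := by simp [hCd, hΦ0, hE0]
  have hall : ∀ᶠ y in 𝓝 (0 : ℂ), y ∈ V ∧ Ψ (Φ y) = y ∧ Φ y ∈ U ∧ (E (Φ y) = 0 → Φ y = 0) :=
    (eventually_mem_set.2 hV).and (hΦr.and ((hΦc.eventually (eventually_mem_set.2 hU)).and (hΦc.eventually hiso)))
  obtain ⟨r, hr, hball⟩ := Metric.eventually_nhds_iff_ball.1 hall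
  have hL' : LipschitzOnWith ⟨ε, hε.le⟩ C (Metric.ball 0 r) := hL.mono fun y hy => (hball y hy).1
  have key : ∀ y ∈ Metric.ball (0 : ℂ) r, E (Φ y) = (C y : ℂ) + (y.im : ℂ) * Complex.I := by
    intro y hy
    have h1 := (hball y hy).2.1
    have h2 : (E (Φ y)).im = y.im := by
      have := congrArg Complex.im h1
      simpa [hΨd] using this
    rw [← h2]
    exact (Complex.re_add_im _).symm
  have hne : ∀ s : ℝ, s ≠ 0 → |s| < r → C s ≠ 0 := by
    intro s hs hsr h
    have hb : (s : ℂ) ∈ Metric.ball (0 : ℂ) r := by simpa using hsr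
    have h1 := key s hb
    rw [h] at h1
    simp at h1
    have h2 := (hball _ hb).2.2.2 h1
    have h3 := (hball _ hb).2.1
    rw [h2, hΨ0] at h3
    exact hs (by exact_mod_cast h3.symm)
  have hr4 : |r / 4| < r / 2 := by rw [abs_of_pos (by linarith)]; linarith
  have hr4' : |-(r / 4)| < r / 2 := by rwa [abs_neg]
  have ev1 : ∀ᶠ w : ℂ in 𝓝 0, ‖w‖ < r / 2 :=
    (continuous_norm.tendsto (0 : ℂ)).eventually (gt_mem_nhds (by simpa using hr))
  filter_upwards [one_side hL' hC0 hr4 (hne _ (by positivity) (by linarith)),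
    one_side hL' hC0 hr4' (hne _ (by linarith [hr]) (by linarith)), ev1] with w h1 h2 h5 h3
  obtain ⟨e, he, τ, hτ, hτ1, hτe⟩ := h1 h3
  obtain ⟨e', he', τ', hτ', hτ1', hτe'⟩ := h2 h3
  have hin : ∀ e τ s0 : ℝ, (e = 1 ∨ e = -1) → 0 < τ → τ ≤ 1 → |s0| < r / 2 →
      (((τ * s0 : ℝ) : ℂ) + ((e * w.im : ℝ) : ℂ) * Complex.I) ∈ Metric.ball (0 : ℂ) r := by
    intro e τ s0 he hτ hτ1 hs0
    have hea : |e| = 1 := by rcases he with rfl | rfl <;> norm_num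
    rw [mem_ball_zero_iff]
    refine (norm_add_le _ _).trans_lt ?_
    rw [norm_mul, Complex.norm_I, mul_one, Complex.norm_real, Real.norm_eq_abs, abs_mul,
      Complex.norm_real, Real.norm_eq_abs, abs_mul, abs_of_pos hτ, hea, one_mul]
    have := mul_le_of_le_one_left (abs_nonneg s0) hτ1
    have := Complex.abs_im_le_norm w
    linarith
  have b1 := hin e τ _ he hτ hτ1 hr4
  have b2 := hin e' τ' _ he' hτ' hτ1' hr4'
  refine ⟨(e, Φ (((τ * (r / 4) : ℝ) : ℂ) + ((e * w.im : ℝ) : ℂ) * Complex.I)),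
    (e', Φ (((τ' * -(r / 4) : ℝ) : ℂ) + ((e' * w.im : ℝ) : ℂ) * Complex.I)), ?_, ?_⟩
  · intro h
    have h7 := congrArg Ψ (Prod.ext_iff.1 h).2
    simp only at h7
    rw [(hball _ b1).2.1, (hball _ b2).2.1] at h7
    have h8 := congrArg Complex.re h7
    simp at h8
    nlinarith
  · have hw : ∀ e : ℝ, ((e * w.re : ℝ) : ℂ) + ((e * w.im : ℝ) : ℂ) * Complex.I = e * w := by
      intro e
      conv_rhs => rw [← Complex.re_add_im w]
      push_cast; ring
    rintro q (rfl | rfl)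
    · refine ⟨he, (hball _ b1).2.2.1, ?_⟩
      simp only
      rw [key _ b1, hτe, ← hw]
      simp
    · refine ⟨he', (hball _ b2).2.2.1, ?_⟩
      simp only
      rw [key _ b2, hτe', ← hw]
      simp

end partP7

section partP8
open Topology Filter MeasureTheory

section lens8
variable {n : ℕ} (z : Fin n → ℂ) (m : Fin n → ℝ) (c g : ℂ)

/-- The lensing map. -/
noncomputable def lensH (x : ℂ) : ℂ := x - (starRingEnd ℂ) (lensr z m 0 g x)

/-- The real derivative of the lensing map. -/
noncomputable def lensT (d : ℂ) : ℂ →L[ℝ] ℂ :=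
  ContinuousLinearMap.id ℝ ℂ - (Complex.conjCLE : ℂ →L[ℝ] ℂ).comp (ContinuousLinearMap.mul ℝ ℂ d)

lemma lensT_apply (d h : ℂ) : lensT d h = h - (starRingEnd ℂ) (d * h) := by
  simp [lensT]

lemma lensT_det (d : ℂ) : (lensT d).det = 1 - ‖d‖ ^ 2 := by
  rw [det_conj_lin (T := lensT d) (s := 1) (d := d)]
  · simp
  · intro h; rw [lensT_apply, one_mul]

lemma mem_imgs_iff (x : ℂ) : x ∈ imgs z m c g ↔ (∀ j, x ≠ z j) ∧ lensH z m g x = (starRingEnd ℂ) c := by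
  have e : lensr z m c g x = c + lensr z m 0 g x := by simp only [lensr]; ring
  constructor
  · rintro ⟨h1, h2⟩
    refine ⟨h1, ?_⟩
    rw [e, map_add] at h2
    rw [lensH, sub_eq_iff_eq_add]; exact h2.symm
  · rintro ⟨h1, h2⟩
    refine ⟨h1, ?_⟩
    rw [lensH, sub_eq_iff_eq_add] at h2
    rw [e, map_add]; exact h2.symm

lemma lensH_deriv {x : ℂ} (hx : ∀ j, x ≠ z j) :
    HasStrictFDerivAt (lensH z m g) (lensT (lensd z m g x)) x := by
  have h1 : HasStrictFDerivAt (lensr z m 0 g) _ x :=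
    (lensr_hasStrictDerivAt z m 0 g hx).hasStrictFDerivAt.restrictScalars ℝ
  have h2 := (Complex.conjCLE.hasStrictFDerivAt (x := lensr z m 0 g x)).comp x h1
  have h3 := (hasStrictFDerivAt_id (𝕜 := ℝ) x).sub h2
  refine h3.congr_fderiv ?_
  ext h
  simp [lensT, mul_comm]

lemma lensH_iso (hn : 0 < n) (hz : Function.Injective z) (hm : ∀ j, 0 < m j) (hg : g ≠ 0) {p : ℂ}
    (hp : p ∈ imgs z m c g) : ∀ᶠ x in 𝓝 p, lensH z m g x = (starRingEnd ℂ) c → x = p := by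
  have hf := (imgs_finite z m c g hn hz hm hg).sdiff (t := {p})
  have := hf.isClosed.isOpen_compl.mem_nhds (x := p) (by simp)
  filter_upwards [this, nonpole_eventually z hp.1] with x h1 h2 h3
  by_contra h
  exact h1 ⟨(mem_imgs_iff z m c g x).2 ⟨h2, h3⟩, h⟩

lemma local_pairs (hn : 0 < n) (hz : Function.Injective z) (hm : ∀ j, 0 < m j) (hg : g ≠ 0) {p : ℂ}
    (hp : p ∈ imgs z m c g) : ∃ a : ℂ, a ≠ 0 ∧ ∀ ε > 0, ∀ U ∈ 𝓝 p, ∀ᶠ w : ℂ in 𝓝 0,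
      ε * ‖w‖ < |(a * w).re| → ∃ q₁ q₂ : ℝ × ℂ, q₁ ≠ q₂ ∧ ∀ q, (q = q₁ ∨ q = q₂) →
      (q.1 = 1 ∨ q.1 = -1) ∧ q.2 ∈ U ∧ lensH z m g q.2 = (starRingEnd ℂ) c + q.1 * w := by
  have hT := lensH_deriv z m g hp.1
  have hp2 := ((mem_imgs_iff z m c g p).1 hp).2
  by_cases hd : ‖lensd z m g p‖ = 1
  · -- fold type image
    obtain ⟨a, ha⟩ := IsAlgClosed.exists_pow_nat_eq (lensd z m g p) (n := 2) (by norm_num)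
    have han : ‖a‖ = 1 := by
      have h1 : ‖a‖ ^ 2 = 1 := by rw [← norm_pow, ha, hd]
      have h0 := norm_nonneg a
      nlinarith
    have hab : a * (starRingEnd ℂ) a = 1 := by
      rw [Complex.mul_conj, Complex.normSq_eq_norm_sq, han]; simp
    have ha0 : a ≠ 0 := left_ne_zero_of_mul_eq_one hab
    refine ⟨a, ha0, ?_⟩
    intro ε hε U hU
    set b := (starRingEnd ℂ) a with hb
    have hcb : (starRingEnd ℂ) b = a := by rw [hb, Complex.conj_conj]
    let A : ℂ → ℂ := fun k => p + b * k
    have hA0 : A 0 = p := by simp [A]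
    have hAc : Tendsto A (𝓝 0) (𝓝 p) := by
      have : Continuous A := by fun_prop
      have := this.tendsto 0
      rwa [hA0] at this
    have hA' : HasStrictFDerivAt A (ContinuousLinearMap.mul ℝ ℂ b) 0 :=
      ((ContinuousLinearMap.mul ℝ ℂ b).hasStrictFDerivAt).const_add p
    let E : ℂ → ℂ := fun k => a * (lensH z m g (A k) - (starRingEnd ℂ) c)
    have hE : HasStrictFDerivAt E ((ContinuousLinearMap.mul ℝ ℂ a).comp
        ((lensT (lensd z m g p)).comp (ContinuousLinearMap.mul ℝ ℂ b))) 0 := by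
      have h1 : HasStrictFDerivAt (lensH z m g) (lensT (lensd z m g p)) (A 0) := by rwa [hA0]
      have h2 := (h1.comp (0 : ℂ) hA').sub_const ((starRingEnd ℂ) c)
      exact (ContinuousLinearMap.mul ℝ ℂ a).hasStrictFDerivAt.comp (0 : ℂ) h2
    have hfold := fold_local hE ?_ ?_ ?_ hε (hAc hU)
    · have hm' : Tendsto (fun w : ℂ => a * w) (𝓝 0) (𝓝 0) := by
        have := (continuous_const_mul a).tendsto 0
        rwa [mul_zero] at this
      filter_upwards [hm'.eventually hfold] with w hw h
      obtain ⟨q₁, q₂, hq, hqq⟩ := hw (by rwa [norm_mul, han, one_mul])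
      refine ⟨(q₁.1, A q₁.2), (q₂.1, A q₂.2), ?_, ?_⟩
      · intro h
        apply hq
        have h1 := Prod.ext_iff.1 h
        refine Prod.ext h1.1 ?_
        have h2 := h1.2
        simp only [A] at h2
        have hb0 : b ≠ 0 := right_ne_zero_of_mul_eq_one hab
        exact mul_left_cancel₀ hb0 (add_left_cancel h2)
      · have main : ∀ q : ℝ × ℂ, (q = q₁ ∨ q = q₂) → (q.1 = 1 ∨ q.1 = -1) ∧ A q.2 ∈ U ∧
            lensH z m g (A q.2) = (starRingEnd ℂ) c + q.1 * w := by
          intro q hq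
          obtain ⟨h1, h2, h3⟩ := hqq q hq
          refine ⟨h1, h2, ?_⟩
          have h4 : a * (lensH z m g (A q.2) - (starRingEnd ℂ) c) = a * (q.1 * w) := by
            rw [mul_left_comm]; exact h3
          have h5 := mul_left_cancel₀ ha0 h4
          rw [← h5]; ring
        rintro q (rfl | rfl)
        · exact main q₁ (Or.inl rfl)
        · exact main q₂ (Or.inr rfl)
    · intro k
      simp only [ContinuousLinearMap.comp_apply, ContinuousLinearMap.mul_apply', lensT_apply]
      rw [← ha, map_mul, map_mul, hcb, map_pow, ← hb]
      have e : a * (b * k - b ^ 2 * (a * (starRingEnd ℂ) k)) = (a * b) * k - (a * b) ^ 2 * (starRingEnd ℂ) k := by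
        ring
      rw [e, hab]
      apply Complex.ext <;> simp
      ring
    · simp only [E]; rw [hA0, hp2, sub_self, mul_zero]
    · filter_upwards [hAc.eventually (lensH_iso z m c g hn hz hm hg hp)] with x h1 h2
      have h3 := h1 (sub_eq_zero.1 ((mul_eq_zero.1 h2).resolve_left ha0))
      simp only [A] at h3
      have hb0 : b ≠ 0 := right_ne_zero_of_mul_eq_one hab
      exact (mul_eq_zero.1 (add_eq_left.1 h3)).resolve_left hb0
  · refine ⟨1, one_ne_zero, ?_⟩
    intro ε hε U hU
    have hdet : (lensT (lensd z m g p)).det ≠ 0 := by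
      rw [lensT_det]
      intro h
      have h0 := norm_nonneg (lensd z m g p)
      apply hd
      nlinarith
    have hT' : HasStrictFDerivAt (lensH z m g)
        (((lensT (lensd z m g p)).toContinuousLinearEquivOfDetNeZero hdet : ℂ ≃L[ℝ] ℂ) : ℂ →L[ℝ] ℂ) p := by
      simpa using hT
    have hmap := hT'.map_nhds_eq_of_equiv
    have him : lensH z m g '' U ∈ 𝓝 ((starRingEnd ℂ) c) := by
      rw [← hp2, ← hmap]; exact image_mem_map hU
    have t1 : Tendsto (fun w : ℂ => (starRingEnd ℂ) c + w) (𝓝 0) (𝓝 ((starRingEnd ℂ) c)) := by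
      have : Continuous (fun w : ℂ => (starRingEnd ℂ) c + w) := by fun_prop
      have := this.tendsto 0
      simpa using this
    have t2 : Tendsto (fun w : ℂ => (starRingEnd ℂ) c - w) (𝓝 0) (𝓝 ((starRingEnd ℂ) c)) := by
      have : Continuous (fun w : ℂ => (starRingEnd ℂ) c - w) := by fun_prop
      have := this.tendsto 0
      simpa using this
    filter_upwards [t1 him, t2 him] with w h1 h2 _
    obtain ⟨x, hx, hxe⟩ := h1
    obtain ⟨y, hy, hye⟩ := h2
    refine ⟨(1, x), (-1, y), ?_, ?_⟩
    · intro h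
      have := (Prod.ext_iff.1 h).1
      norm_num at this
    · rintro q (rfl | rfl)
      · exact ⟨Or.inl rfl, hx, by simpa using hxe⟩
      · refine ⟨Or.inr rfl, hy, ?_⟩
        simp only
        rw [hye]; push_cast; ring

lemma lensH_sard : volume (lensH z m g '' {x | (∀ j, x ≠ z j) ∧ ‖lensd z m g x‖ = 1}) = 0 := by
  apply addHaar_image_eq_zero_of_det_fderivWithin_eq_zero volume
    (f' := fun x => lensT (lensd z m g x))
  · intro x hx
    exact (lensH_deriv z m g hx.1).hasFDerivAt.hasFDerivWithinAt
  · intro x hx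
    rw [lensT_det, hx.2]; norm_num

lemma exists_dir {Z : Set ℂ} (hZ : Z.Finite) {a : ℂ → ℂ} (ha : ∀ p ∈ Z, a p ≠ 0) :
    ∃ u : ℂ, ∀ p ∈ Z, (a p * u).re ≠ 0 := by
  obtain ⟨s, hs⟩ := (hZ.image fun p => (a p).re / (a p).im).infinite_compl.nonempty
  refine ⟨1 + s * Complex.I, fun p hp h => ?_⟩
  have e : (a p * (1 + s * Complex.I)).re = (a p).re - s * (a p).im := by
    simp; ring
  rw [e] at h
  by_cases hi : (a p).im = 0
  · rw [hi] at h
    apply ha p hp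
    apply Complex.ext
    · simpa using h
    · simpa using hi
  · apply hs
    refine ⟨p, hp, ?_⟩
    simp only
    rw [div_eq_iff hi]; linarith

lemma imgs_bound_of_regular (hn : 0 < n) (hz : Function.Injective z) (hm : ∀ j, 0 < m j) (hg : g ≠ 0)
    {M : ℕ} (hM : ∀ c, (∀ x ∈ imgs z m c g, ‖lensd z m g x‖ ≠ 1) → (imgs z m c g).ncard ≤ M) :
    (imgs z m c g).ncard ≤ M := by
  classical
  have hZ := imgs_finite z m c g hn hz hm hg
  set Z := imgs z m c g with hZd
  have hloc : ∀ p : ℂ, ∃ a : ℂ, p ∈ Z → (a ≠ 0 ∧ ∀ ε > 0, ∀ U ∈ 𝓝 p, ∀ᶠ w : ℂ in 𝓝 0,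
      ε * ‖w‖ < |(a * w).re| → ∃ q₁ q₂ : ℝ × ℂ, q₁ ≠ q₂ ∧ ∀ q, (q = q₁ ∨ q = q₂) →
      (q.1 = 1 ∨ q.1 = -1) ∧ q.2 ∈ U ∧ lensH z m g q.2 = (starRingEnd ℂ) c + q.1 * w) := by
    intro p
    by_cases hp : p ∈ Z
    · obtain ⟨a, ha⟩ := local_pairs z m c g hn hz hm hg hp
      exact ⟨a, fun _ => ha⟩
    · exact ⟨0, fun h => absurd h hp⟩
  choose a ha using hloc
  obtain ⟨u, hu⟩ := exists_dir hZ (fun p hp => (ha p hp).1)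
  -- disjoint neighbourhoods
  obtain ⟨V, hV, hVd⟩ := hZ.t2_separation
  have hU : ∀ p ∈ Z, V p ∩ {x | ∀ j, x ≠ z j} ∈ 𝓝 p := fun p hp =>
    inter_mem ((hV p).2.mem_nhds (hV p).1) (nonpole_eventually z hp.1)
  -- choice of ε
  have hε : ∀ᶠ ε : ℝ in 𝓝[>] 0, ∀ p ∈ Z, ε * ‖u‖ < |(a p * u).re| := by
    rw [eventually_all_finite hZ]
    intro p hp
    apply eventually_nhdsWithin_of_eventually_nhds
    have : Tendsto (fun ε : ℝ => ε * ‖u‖) (𝓝 0) (𝓝 (0 * ‖u‖)) := tendsto_id.mul_const _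
    rw [zero_mul] at this
    exact this.eventually (gt_mem_nhds (abs_pos.2 (hu p hp)))
  obtain ⟨ε, hε, hε0⟩ := (hε.and self_mem_nhdsWithin).exists
  have hε0 : 0 < ε := hε0
  have hW : ∀ᶠ w : ℂ in 𝓝 0, ∀ p ∈ Z, ε * ‖w‖ < |(a p * w).re| → ∃ q₁ q₂ : ℝ × ℂ, q₁ ≠ q₂ ∧
      ∀ q, (q = q₁ ∨ q = q₂) → (q.1 = 1 ∨ q.1 = -1) ∧ q.2 ∈ V p ∩ {x | ∀ j, x ≠ z j} ∧
        lensH z m g q.2 = (starRingEnd ℂ) c + q.1 * w := by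
    rw [eventually_all_finite hZ]
    intro p hp
    exact (ha p hp).2 ε hε0 _ (hU p hp)
  obtain ⟨W, hWs, hWo, hW0⟩ := eventually_nhds_iff.1 hW
  let O : Set ℂ := W ∩ ⋂ p ∈ Z, {w | ε * ‖w‖ < |(a p * w).re|}
  have hO : IsOpen O := by
    refine hWo.inter (hZ.isOpen_biInter fun p _ => ?_)
    exact isOpen_lt (by fun_prop) (by fun_prop)
  have hOne : O.Nonempty := by
    have ht : Tendsto (fun t : ℝ => (t : ℂ) * u) (𝓝[>] 0) (𝓝 0) := by
      have : Continuous (fun t : ℝ => (t : ℂ) * u) := by fun_prop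
      have := this.tendsto 0
      simp only [Complex.ofReal_zero, zero_mul] at this
      exact this.mono_left nhdsWithin_le_nhds
    obtain ⟨t, ht1, ht2⟩ := ((ht.eventually (hWo.mem_nhds hW0)).and self_mem_nhdsWithin).exists
    have ht2 : 0 < t := ht2
    refine ⟨t * u, ht1, ?_⟩
    simp only [Set.mem_iInter]
    intro p hp
    change ε * ‖(t : ℂ) * u‖ < |(a p * (t * u)).re|
    rw [mul_left_comm (a p), Complex.re_ofReal_mul, abs_mul, norm_mul, Complex.norm_real,
      Real.norm_eq_abs, mul_left_comm]
    exact mul_lt_mul_of_pos_left (hε p hp) (abs_pos.2 ht2.ne')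
  -- Sard
  set N := lensH z m g '' {x | (∀ j, x ≠ z j) ∧ ‖lensd z m g x‖ = 1} with hN
  have hN0 : volume N = 0 := lensH_sard z m g
  have n1 : volume ((fun w : ℂ => (starRingEnd ℂ) c + w) ⁻¹' N) = 0 := by
    rw [measure_preimage_add]; exact hN0
  have n2 : volume ((fun w : ℂ => (starRingEnd ℂ) c - w) ⁻¹' N) = 0 :=
    (quasiMeasurePreserving_sub_left volume ((starRingEnd ℂ) c)).preimage_null hN0
  have hpos := hO.measure_pos volume hOne
  obtain ⟨w, hwO, hw1, hw2⟩ : ∃ w ∈ O, (starRingEnd ℂ) c + w ∉ N ∧ (starRingEnd ℂ) c - w ∉ N := by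
    by_contra hcon
    push Not at hcon
    have : O ⊆ ((fun w : ℂ => (starRingEnd ℂ) c + w) ⁻¹' N) ∪ ((fun w : ℂ => (starRingEnd ℂ) c - w) ⁻¹' N) := by
      intro w hw
      by_cases h : (starRingEnd ℂ) c + w ∈ N
      · exact Or.inl h
      · exact Or.inr (hcon w hw h)
    exact hpos.ne' (measure_mono_null this (measure_union_null n1 n2))
  -- counting
  have hreg : ∀ v : ℂ, v ∉ N → (imgs z m ((starRingEnd ℂ) v) g).ncard ≤ M := by
    intro v hv
    apply hM
    intro x hx h1
    rw [mem_imgs_iff, Complex.conj_conj] at hx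
    exact hv ⟨x, ⟨hx.1, h1⟩, hx.2⟩
  have hc1 := hreg _ hw1
  have hc2 := hreg _ hw2
  have hf1 := imgs_finite z m ((starRingEnd ℂ) ((starRingEnd ℂ) c + w)) g hn hz hm hg
  have hf2 := imgs_finite z m ((starRingEnd ℂ) ((starRingEnd ℂ) c - w)) g hn hz hm hg
  set A := imgs z m ((starRingEnd ℂ) ((starRingEnd ℂ) c + w)) g with hA
  set B := imgs z m ((starRingEnd ℂ) ((starRingEnd ℂ) c - w)) g with hB
  let S : Set (ℝ × ℂ) := (fun x => ((1 : ℝ), x)) '' A ∪ (fun x => ((-1 : ℝ), x)) '' B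
  have hSf : S.Finite := (hf1.image _).union (hf2.image _)
  have hSc : S.ncard ≤ 2 * M := by
    refine (Set.ncard_union_le _ _).trans ?_
    have := Set.ncard_image_le (f := fun x => ((1 : ℝ), x)) hf1
    have := Set.ncard_image_le (f := fun x => ((-1 : ℝ), x)) hf2
    omega
  have hex : ∀ p : ℂ, ∃ q₁ q₂ : ℝ × ℂ, p ∈ Z → q₁ ≠ q₂ ∧ ∀ q, (q = q₁ ∨ q = q₂) →
      q ∈ S ∧ q.2 ∈ V p := by
    intro p
    by_cases hp : p ∈ Z
    · have hwp : ε * ‖w‖ < |(a p * w).re| := by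
        have := hwO.2
        simp only [Set.mem_iInter] at this
        exact this p hp
      obtain ⟨q₁, q₂, h1, h2⟩ := hWs w hwO.1 p hp hwp
      refine ⟨q₁, q₂, fun _ => ⟨h1, fun q hq => ?_⟩⟩
      obtain ⟨h3, h4, h5⟩ := h2 q hq
      refine ⟨?_, h4.1⟩
      rcases h3 with h3 | h3
      · left
        refine ⟨q.2, ?_, Prod.ext h3.symm rfl⟩
        rw [hA, mem_imgs_iff, Complex.conj_conj]
        refine ⟨h4.2, ?_⟩
        rw [h5, h3]; simp
      · right
        refine ⟨q.2, ?_, Prod.ext h3.symm rfl⟩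
        rw [hB, mem_imgs_iff, Complex.conj_conj]
        refine ⟨h4.2, ?_⟩
        rw [h5, h3]; push_cast; ring
    · exact ⟨0, 0, fun h => absurd h hp⟩
  choose q₁ q₂ hq using hex
  have hVe : ∀ p ∈ Z, ∀ p' ∈ Z, ∀ x, x ∈ V p → x ∈ V p' → p = p' := by
    intro p hp p' hp' x hx hx'
    by_contra hne
    exact Set.disjoint_left.1 (hVd hp hp' hne) hx hx'
  have i1 : Set.InjOn q₁ Z := by
    intro p hp p' hp' h
    refine hVe p hp p' hp' _ ((hq p hp).2 _ (Or.inl rfl)).2 ?_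
    rw [h]; exact ((hq p' hp').2 _ (Or.inl rfl)).2
  have i2 : Set.InjOn q₂ Z := by
    intro p hp p' hp' h
    refine hVe p hp p' hp' _ ((hq p hp).2 _ (Or.inr rfl)).2 ?_
    rw [h]; exact ((hq p' hp').2 _ (Or.inr rfl)).2
  have hdj : Disjoint (q₁ '' Z) (q₂ '' Z) := by
    rw [Set.disjoint_left]
    rintro _ ⟨p, hp, rfl⟩ ⟨p', hp', h⟩
    have : p = p' := by
      refine hVe p hp p' hp' _ ((hq p hp).2 _ (Or.inl rfl)).2 ?_
      rw [← h]; exact ((hq p' hp').2 _ (Or.inr rfl)).2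
    subst this
    exact (hq p hp).1 h.symm
  have hsub : q₁ '' Z ∪ q₂ '' Z ⊆ S := by
    rintro _ (⟨p, hp, rfl⟩ | ⟨p, hp, rfl⟩)
    · exact ((hq p hp).2 _ (Or.inl rfl)).1
    · exact ((hq p hp).2 _ (Or.inr rfl)).1
  have hle := Set.ncard_le_ncard hsub hSf
  rw [Set.ncard_union_eq hdj (hZ.image _) (hZ.image _), i1.ncard_image, i2.ncard_image] at hle
  omega

end lens8

end partP8

open Topology Filter MeasureTheory

section lens9
variable {n : ℕ} (z : Fin n → ℂ) (m : Fin n → ℝ) (c g : ℂ)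

lemma imgs_bound_ne (hn : 2 ≤ n) (hz : Function.Injective z) (hm : ∀ j, 0 < m j) (hg : g ≠ 0)
    (hg1 : ‖g‖ ≠ 1) : (imgs z m c g).ncard ≤ 5 * n - 1 :=
  imgs_bound_of_regular z m c g (by omega) hz hm hg
    fun c hc => imgs_regular_bound z m c g hn hz hm hg hg1 hc

lemma lensH_perturb (ε : ℝ) (x : ℂ) : lensH z m (((1 - ε : ℝ) : ℂ) * g) x =
    lensH z m g x + ε • (starRingEnd ℂ) (g * x) := by
  simp only [lensH, lensr, map_add, map_mul, Complex.conj_ofReal, Complex.real_smul]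
  push_cast
  ring

lemma image_persist {p : ℂ} (hp : p ∈ imgs z m c g) (hreg : ‖lensd z m g p‖ ≠ 1) {U : Set ℂ}
    (hU : U ∈ 𝓝 p) : ∀ᶠ ε : ℝ in 𝓝 0,
      ∃ x ∈ U, lensH z m (((1 - ε : ℝ) : ℂ) * g) x = (starRingEnd ℂ) c := by
  have hp2 := ((mem_imgs_iff z m c g p).1 hp).2
  have hT := lensH_deriv z m g hp.1
  have hdet : (lensT (lensd z m g p)).det ≠ 0 := by
    rw [lensT_det]
    intro h
    have h0 := norm_nonneg (lensd z m g p)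
    apply hreg
    nlinarith
  let T := (lensT (lensd z m g p)).toContinuousLinearEquivOfDetNeZero hdet
  have hTT : ∀ h, T h = lensT (lensd z m g p) h := fun h => by simp [T]
  let G : ℝ × ℂ → ℝ × ℂ := fun q => (q.1, lensH z m g q.2 + q.1 • (starRingEnd ℂ) (g * q.2))
  let K : ℂ →L[ℝ] ℂ := (Complex.conjCLE : ℂ →L[ℝ] ℂ).comp (ContinuousLinearMap.mul ℝ ℂ g)
  have hG : HasStrictFDerivAt G ((ContinuousLinearMap.fst ℝ ℝ ℂ).prod
      (((lensT (lensd z m g p)).comp (ContinuousLinearMap.snd ℝ ℝ ℂ)) +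
        ((0 : ℝ) • (K.comp (ContinuousLinearMap.snd ℝ ℝ ℂ)) +
          (ContinuousLinearMap.fst ℝ ℝ ℂ).smulRight (K p)))) ((0 : ℝ), p) := by
    have h1 : HasStrictFDerivAt (fun q : ℝ × ℂ => q.1) (ContinuousLinearMap.fst ℝ ℝ ℂ) ((0 : ℝ), p) :=
      hasStrictFDerivAt_fst
    have h2 : HasStrictFDerivAt (fun q : ℝ × ℂ => q.2) (ContinuousLinearMap.snd ℝ ℝ ℂ) ((0 : ℝ), p) :=
      hasStrictFDerivAt_snd
    have h3 : HasStrictFDerivAt (fun q : ℝ × ℂ => lensH z m g q.2) _ ((0 : ℝ), p) :=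
      HasStrictFDerivAt.comp ((0 : ℝ), p) (f := fun q : ℝ × ℂ => q.2) hT h2
    have h4 : HasStrictFDerivAt (fun q : ℝ × ℂ => K q.2) _ ((0 : ℝ), p) :=
      K.hasStrictFDerivAt.comp ((0 : ℝ), p) h2
    exact h1.prodMk (h3.add (h1.smul h4))
  have hsurj : (((ContinuousLinearMap.fst ℝ ℝ ℂ).prod
      (((lensT (lensd z m g p)).comp (ContinuousLinearMap.snd ℝ ℝ ℂ)) +
        ((0 : ℝ) • (K.comp (ContinuousLinearMap.snd ℝ ℝ ℂ)) +
          (ContinuousLinearMap.fst ℝ ℝ ℂ).smulRight (K p)))) : ℝ × ℂ →L[ℝ] ℝ × ℂ).range = ⊤ := by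
    rw [LinearMap.range_eq_top]
    rintro ⟨δ, v⟩
    refine ⟨(δ, T.symm (v - δ • K p)), ?_⟩
    have := hTT (T.symm (v - δ • K p))
    rw [T.apply_symm_apply] at this
    apply Prod.ext
    · simp
    · change lensT (lensd z m g p) (T.symm (v - δ • K p)) + ((0 : ℝ) • _ + δ • K p) = v
      rw [← this, zero_smul]; abel
  have hmap := hG.map_nhds_eq_of_surj hsurj
  have hG0 : G ((0 : ℝ), p) = (0, (starRingEnd ℂ) c) := by
    simp only [G]; rw [hp2]; simp
  have him : G '' (Set.univ ×ˢ U) ∈ 𝓝 ((0 : ℝ), (starRingEnd ℂ) c) := by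
    rw [← hG0, ← hmap]
    exact image_mem_map (prod_mem_nhds univ_mem hU)
  have ht : Tendsto (fun ε : ℝ => (ε, (starRingEnd ℂ) c)) (𝓝 0) (𝓝 ((0 : ℝ), (starRingEnd ℂ) c)) :=
    (Continuous.prodMk continuous_id continuous_const).tendsto 0
  filter_upwards [ht him] with ε hε
  obtain ⟨q, hq, hqe⟩ := hε
  have h1 : q.1 = ε := congrArg Prod.fst hqe
  have h2 : lensH z m g q.2 + q.1 • (starRingEnd ℂ) (g * q.2) = (starRingEnd ℂ) c :=
    congrArg Prod.snd hqe
  exact ⟨q.2, hq.2, by rw [lensH_perturb, ← h1, h2]⟩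

lemma imgs_bound_one (hn : 2 ≤ n) (hz : Function.Injective z) (hm : ∀ j, 0 < m j)
    (hg1 : ‖g‖ = 1) : (imgs z m c g).ncard ≤ 5 * n - 1 := by
  have hg : g ≠ 0 := by
    rintro rfl; simp at hg1
  refine imgs_bound_of_regular z m c g (by omega) hz hm hg ?_
  intro c hc
  have hZ := imgs_finite z m c g (by omega) hz hm hg
  set Z := imgs z m c g with hZd
  obtain ⟨V, hV, hVd⟩ := hZ.t2_separation
  have hev : ∀ᶠ ε : ℝ in 𝓝[>] 0, ∀ p ∈ Z, ∃ x ∈ V p ∩ {x | ∀ j, x ≠ z j},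
      lensH z m (((1 - ε : ℝ) : ℂ) * g) x = (starRingEnd ℂ) c := by
    rw [eventually_all_finite hZ]
    intro p hp
    apply eventually_nhdsWithin_of_eventually_nhds
    exact image_persist z m c g hp (hc p hp)
      (inter_mem ((hV p).2.mem_nhds (hV p).1) (nonpole_eventually z hp.1))
  have hev2 : ∀ᶠ ε : ℝ in 𝓝[>] 0, ε < 1 :=
    eventually_nhdsWithin_of_eventually_nhds (gt_mem_nhds one_pos)
  obtain ⟨ε, ⟨hε, hε1⟩, hε0⟩ := ((hev.and hev2).and self_mem_nhdsWithin).exists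
  have hε0 : 0 < ε := hε0
  set g' := ((1 - ε : ℝ) : ℂ) * g with hg'
  have hn' : ‖g'‖ = 1 - ε := by
    rw [hg', norm_mul, hg1, mul_one, Complex.norm_real, Real.norm_eq_abs, abs_of_pos (by linarith)]
  have hg'0 : g' ≠ 0 := by
    rw [← norm_ne_zero_iff, hn']; linarith
  have hb := imgs_bound_ne z m c g' hn hz hm hg'0 (by rw [hn']; linarith)
  refine le_trans ?_ hb
  choose! f hf1 hf2 using hε
  refine Set.ncard_le_ncard_of_injOn f ?_ ?_ (imgs_finite z m c g' (by omega) hz hm hg'0)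
  · intro p hp
    exact (mem_imgs_iff z m c g' _).2 ⟨(hf1 p hp).2, hf2 p hp⟩
  · intro p hp p' hp' h
    by_contra hne
    refine Set.disjoint_left.1 (hVd hp hp' hne) (hf1 p hp).1 ?_
    rw [h]; exact (hf1 p' hp').1

lemma imgs_bound (hn : 2 ≤ n) (hz : Function.Injective z) (hm : ∀ j, 0 < m j) (hg : g ≠ 0) :
    (imgs z m c g).ncard ≤ 5 * n - 1 := by
  by_cases h : ‖g‖ = 1
  · exact imgs_bound_one z m c g hn hz hm h
  · exact imgs_bound_ne z m c g hn hz hm hg h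

end lens9

/-- An–Evans improvement: a point lens on `n ≥ 2` masses with
nonzero external shear produces at most `5n - 1` images of any source `ζ`. -/
theorem an_evans_bound
    (n : ℕ) (hn : 2 ≤ n)
    (z : Fin n → ℂ) (hz : Function.Injective z)
    (m : Fin n → ℝ) (hm : ∀ j, 0 < m j)
    (γ : ℂ) (hγ : γ ≠ 0)
    (η : ℂ → ℂ)
    (hη : ∀ x : ℂ, η x =
      x - γ * (starRingEnd ℂ) x
        - ∑ j, (m j : ℂ) / ((starRingEnd ℂ) x - (starRingEnd ℂ) (z j)))
    (ζ : ℂ) :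
    {x : ℂ | (∀ j, x ≠ z j) ∧ η x = ζ}.Finite ∧
      {x : ℂ | (∀ j, x ≠ z j) ∧ η x = ζ}.ncard ≤ 5 * n - 1 := by
  have hset : {x : ℂ | (∀ j, x ≠ z j) ∧ η x = ζ} =
      imgs z m ((starRingEnd ℂ) ζ) ((starRingEnd ℂ) γ) := by
    ext x
    rw [mem_imgs_iff, Complex.conj_conj]
    have : lensH z m ((starRingEnd ℂ) γ) x = η x := by
      rw [hη]
      simp only [lensH, lensr, map_add, map_mul, map_sum, map_div₀, map_sub, map_zero,
        Complex.conj_conj, Complex.conj_ofReal]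
      ring
    rw [this]
    rfl
  have hg : (starRingEnd ℂ) γ ≠ 0 := (map_ne_zero _).2 hγ
  rw [hset]
  exact ⟨imgs_finite z m _ _ (by omega) hz hm hg, imgs_bound z m _ _ hn hz hm hg⟩
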